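/- arXiv:1809.02998 — 4 statements merged into one kernel-verified Lean document; each statement's English description precedes it below -/
import Mathlib

section
/- (Asymptotic limits, Lemma 2.1.) Let f̄ ≥ 0 and let W : ℝ → [0,1] be a continuously differentiable solution of W(x)·v(A(W;x)) = f̄ for all x ∈ ℝ, with lim_{x→−∞} W(x) = ρ⁻, lim_{x→+∞} W(x) = ρ⁺, lim_{x→±∞} W'(x) = 0, and f̄ = ρ⁻v(ρ⁻) = ρ⁺v(ρ⁺). (i) If W(x) ≠ ρ⁺ for all x, then there exist constants C > 0 and λ > 0 with |W(x) − ρ⁺| ≤ C·e^{−λx} for all x ≥ 0 if and only if ρ⁺ > ρ̂. (ii) If W(x) ≠ ρ⁻ for all x, then there exist constants C > 0 and λ > 0 with |W(x) − ρ⁻| ≤ C·e^{λx} for all x ≤ 0 if and only if ρ⁻ < ρ̂. -/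
open Set Filter Topology MeasureTheory

/-- The nonlocal average `A(Q;x) = ∫₀ʰ Q(x+s) w(s) ds`. -/
noncomputable def avg (h : ℝ) (w Q : ℝ → ℝ) (x : ℝ) : ℝ := ∫ s in (0:ℝ)..h, Q (x + s) * w s

/-- The properties of an averaging weight on `(0,h)` used throughout. -/
structure IsAvgWeight (h : ℝ) (w : ℝ → ℝ) : Prop where
  length_pos : 0 < h
  intervalIntegrable : IntervalIntegrable w volume 0 h
  nonneg : ∀ s, 0 ≤ w s
  pos : ∀ s ∈ Ioo 0 h, 0 < w s
  integral_eq_one : ∫ s in (0:ℝ)..h, w s = 1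

namespace IsAvgWeight

variable {h : ℝ} {w : ℝ → ℝ} {P Q : ℝ → ℝ}

lemma intervalIntegrable_mul (hk : IsAvgWeight h w) (hQ : Continuous Q) (x : ℝ) :
    IntervalIntegrable (fun s => Q (x + s) * w s) volume 0 h :=
  hk.intervalIntegrable.continuousOn_mul (by fun_prop)

lemma avg_mono (hk : IsAvgWeight h w) (hP : Continuous P) (hQ : Continuous Q) {x : ℝ}
    (hPQ : ∀ s ∈ Icc 0 h, P (x + s) ≤ Q (x + s)) : avg h w P x ≤ avg h w Q x :=
  intervalIntegral.integral_mono_on hk.length_pos.le (hk.intervalIntegrable_mul hP x)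
    (hk.intervalIntegrable_mul hQ x)
    fun s hs => mul_le_mul_of_nonneg_right (hPQ s hs) (hk.nonneg s)

lemma avg_const (hk : IsAvgWeight h w) (c x : ℝ) : avg h w (fun _ => c) x = c := by
  simp [avg, hk.integral_eq_one]

lemma avg_le_of_le (hk : IsAvgWeight h w) (hQ : Continuous Q) {x c : ℝ}
    (hc : ∀ s ∈ Icc 0 h, Q (x + s) ≤ c) : avg h w Q x ≤ c :=
  (hk.avg_mono hQ continuous_const hc).trans_eq (hk.avg_const c x)

lemma le_avg_of_le (hk : IsAvgWeight h w) (hQ : Continuous Q) {x c : ℝ}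
    (hc : ∀ s ∈ Icc 0 h, c ≤ Q (x + s)) : c ≤ avg h w Q x :=
  (hk.avg_const c x).symm.trans_le (hk.avg_mono continuous_const hQ hc)

lemma avg_const_mul (c x : ℝ) : avg h w (fun t => c * Q t) x = c * avg h w Q x := by
  simp only [avg, mul_assoc, intervalIntegral.integral_const_mul]

lemma avg_sub_const (hk : IsAvgWeight h w) (hQ : Continuous Q) (c x : ℝ) :
    avg h w (fun t => Q t - c) x = avg h w Q x - c := by
  have := hk.avg_const c x
  unfold avg at *
  simp only [sub_mul]
  rw [intervalIntegral.integral_sub (hk.intervalIntegrable_mul hQ x)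
    (hk.intervalIntegrable.const_mul c), this]

lemma avg_pos (hk : IsAvgWeight h w) (hQ : Continuous Q) (hQ0 : ∀ t, 0 ≤ Q t) {x : ℝ}
    (hx : 0 < Q x) : 0 < avg h w Q x := by
  obtain ⟨e, he, hpos⟩ := Metric.eventually_nhds_iff.1 (hQ.continuousAt.eventually_const_lt hx)
  set d := min (e / 2) (h / 2)
  have hh := hk.length_pos
  have hd : 0 < d := lt_min (by linarith) (by linarith)
  have hdh : d < h := (min_le_right _ _).trans_lt (by linarith)
  have hde : d < e := (min_le_left _ _).trans_lt (by linarith)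
  have hint := hk.intervalIntegrable_mul hQ x
  have hint1 : IntervalIntegrable (fun s => Q (x + s) * w s) volume 0 d :=
    hint.mono_set (by rw [uIcc_of_le hd.le, uIcc_of_le hh.le]; exact Icc_subset_Icc le_rfl hdh.le)
  have hint2 : IntervalIntegrable (fun s => Q (x + s) * w s) volume d h :=
    hint.mono_set (by rw [uIcc_of_le hdh.le, uIcc_of_le hh.le]; exact Icc_subset_Icc hd.le le_rfl)
  unfold avg
  rw [← intervalIntegral.integral_add_adjacent_intervals hint1 hint2]
  refine add_pos_of_pos_of_nonneg
    (intervalIntegral.intervalIntegral_pos_of_pos_on hint1 (fun s hs => ?_) hd)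
    (intervalIntegral.integral_nonneg hdh.le fun s _ => mul_nonneg (hQ0 _) (hk.nonneg s))
  refine mul_pos (hpos ?_) (hk.pos s ⟨hs.1, hs.2.trans hdh⟩)
  rw [Real.dist_eq, add_sub_cancel_left, abs_of_pos hs.1]
  exact hs.2.trans hde

lemma tendsto_avg (hk : IsAvgWeight h w) (hQ : Continuous Q) {B ρ : ℝ} (hB : ∀ t, |Q t| ≤ B)
    {l : Filter ℝ} [l.IsCountablyGenerated] (hl : ∀ s : ℝ, Tendsto (fun x => x + s) l l)
    (hlim : Tendsto Q l (𝓝 ρ)) : Tendsto (avg h w Q) l (𝓝 ρ) := by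
  have key : Tendsto (avg h w Q) l (𝓝 (∫ s in (0:ℝ)..h, ρ * w s)) := by
    refine intervalIntegral.tendsto_integral_filter_of_dominated_convergence
      (fun s => B * w s) ?_ ?_ (hk.intervalIntegrable.const_mul B) ?_
    · exact Eventually.of_forall fun x => (hk.intervalIntegrable_mul hQ x).aestronglyMeasurable_restrict_uIoc
    · refine Eventually.of_forall fun x => Eventually.of_forall fun s _ => ?_
      rw [norm_mul, Real.norm_eq_abs, Real.norm_eq_abs, abs_of_nonneg (hk.nonneg s)]
      exact mul_le_mul_of_nonneg_right (hB _) (hk.nonneg s)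
    · exact Eventually.of_forall fun s _ => (hlim.comp (hl s)).mul_const _
  rwa [intervalIntegral.integral_const_mul, hk.integral_eq_one, mul_one] at key

lemma hasDerivAt_avg (hk : IsAvgWeight h w) {Y y : ℝ → ℝ} (hY : ∀ x, HasDerivAt Y (y x) x)
    (hy : Continuous y) {B : ℝ} (hB : ∀ x, |y x| ≤ B) (x : ℝ) :
    HasDerivAt (avg h w Y) (avg h w y x) x := by
  have hYc : Continuous Y := continuous_iff_continuousAt.2 fun x => (hY x).continuousAt
  refine (intervalIntegral.hasDerivAt_integral_of_dominated_loc_of_deriv_le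
    (F := fun x s => Y (x + s) * w s) (F' := fun x s => y (x + s) * w s)
    (bound := fun s => B * w s) (s := univ) univ_mem ?_ (hk.intervalIntegrable_mul hYc x) ?_ ?_
    (hk.intervalIntegrable.const_mul B) ?_).2
  · exact Eventually.of_forall fun x => (hk.intervalIntegrable_mul hYc x).aestronglyMeasurable_restrict_uIoc
  · exact (hk.intervalIntegrable_mul hy x).aestronglyMeasurable_restrict_uIoc
  · refine Eventually.of_forall fun s _ x _ => ?_
    rw [norm_mul, Real.norm_eq_abs, Real.norm_eq_abs, abs_of_nonneg (hk.nonneg s)]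
    exact mul_le_mul_of_nonneg_right (hB _) (hk.nonneg s)
  · exact Eventually.of_forall fun s _ x _ => ((hY (x + s)).comp_add_const x s).mul_const _

/-- Since the second half of the weight has positive mass `θ`, the forward average of a monotone
function sees its value half a horizon ahead. -/
lemma exists_half_split (hk : IsAvgWeight h w) : ∃ θ : ℝ, 0 < θ ∧ θ ≤ 1 ∧
    ∀ Y : ℝ → ℝ, Continuous Y → Monotone Y → ∀ x,
      (1 - θ) * Y x + θ * Y (x + h / 2) ≤ avg h w Y x := by
  have hh := hk.length_pos
  have hsub1 : uIcc 0 (h / 2) ⊆ uIcc 0 h := by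
    rw [uIcc_of_le (by linarith), uIcc_of_le hh.le]; exact Icc_subset_Icc le_rfl (by linarith)
  have hsub2 : uIcc (h / 2) h ⊆ uIcc 0 h := by
    rw [uIcc_of_le (by linarith), uIcc_of_le hh.le]; exact Icc_subset_Icc (by linarith) le_rfl
  have hi1 := hk.intervalIntegrable.mono_set hsub1
  have hi2 := hk.intervalIntegrable.mono_set hsub2
  have hsum := intervalIntegral.integral_add_adjacent_intervals hi1 hi2
  rw [hk.integral_eq_one] at hsum
  refine ⟨∫ s in (h / 2)..h, w s, ?_, ?_, fun Y hYc hYm x => ?_⟩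
  · exact intervalIntegral.intervalIntegral_pos_of_pos_on hi2
      (fun s hs => hk.pos s ⟨by linarith [hs.1], hs.2⟩) (by linarith)
  · have : 0 ≤ ∫ s in (0:ℝ)..(h / 2), w s :=
      intervalIntegral.integral_nonneg (by linarith) fun s _ => hk.nonneg s
    linarith
  · have hint := hk.intervalIntegrable_mul hYc x
    unfold avg
    rw [← intervalIntegral.integral_add_adjacent_intervals (hint.mono_set hsub1)
      (hint.mono_set hsub2), ← hsum, add_sub_cancel_right, mul_comm _ (Y x),
      mul_comm _ (Y (x + h / 2)), ← intervalIntegral.integral_const_mul,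
      ← intervalIntegral.integral_const_mul]
    refine add_le_add (intervalIntegral.integral_mono_on (by linarith) (hi1.const_mul _)
      (hint.mono_set hsub1) fun s hs => ?_) (intervalIntegral.integral_mono_on (by linarith)
      (hi2.const_mul _) (hint.mono_set hsub2) fun s hs => ?_)
    · exact mul_le_mul_of_nonneg_right (hYm (by linarith [hs.1])) (hk.nonneg s)
    · exact mul_le_mul_of_nonneg_right (hYm (by linarith [hs.1])) (hk.nonneg s)

end IsAvgWeight

lemma nonneg_of_deriv_nonpos_of_tendsto_zero {Φ Φ' : ℝ → ℝ} {X : ℝ}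
    (hΦ : ∀ x, HasDerivAt Φ (Φ' x) x) (hΦ' : ∀ x ≥ X, Φ' x ≤ 0) (hlim : Tendsto Φ atTop (𝓝 0)) :
    ∀ x ≥ X, 0 ≤ Φ x := by
  have hanti : AntitoneOn Φ (Ici X) := by
    refine antitoneOn_of_deriv_nonpos (convex_Ici X)
      (fun x _ => (hΦ x).continuousAt.continuousWithinAt)
      (fun x _ => (hΦ x).differentiableAt.differentiableWithinAt) fun x hx => ?_
    rw [(hΦ x).deriv]
    exact hΦ' x (interior_subset hx)
  intro x hx
  refine le_of_tendsto hlim ?_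
  filter_upwards [eventually_ge_atTop x] with t ht
  exact hanti hx (hx.le.trans ht) ht

lemma nonneg_of_deriv_nonneg_of_tendsto_zero {Φ Φ' : ℝ → ℝ} {X : ℝ}
    (hΦ : ∀ x, HasDerivAt Φ (Φ' x) x) (hΦ' : ∀ x ≤ X, 0 ≤ Φ' x) (hlim : Tendsto Φ atBot (𝓝 0)) :
    ∀ x ≤ X, 0 ≤ Φ x := by
  intro x hx
  have := nonneg_of_deriv_nonpos_of_tendsto_zero (Φ := fun x => Φ (-x)) (Φ' := fun x => -Φ' (-x))
    (X := -X) (fun x => by simpa [Function.comp_def] using (hΦ (-x)).scomp x (hasDerivAt_neg x))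
    (fun x hx => by have := hΦ' (-x) (by linarith); linarith)
    (hlim.comp tendsto_neg_atTop_atBot) (-x) (by linarith)
  simpa using this

lemma exists_tail_primitive {y : ℝ → ℝ} (hy : Continuous y) (hy0 : ∀ x, 0 < y x)
    {X B : ℝ} (hB : ∀ T ≥ X, ∫ t in (0:ℝ)..T, y t ≤ B) :
    ∃ J : ℝ → ℝ, (∀ x, HasDerivAt J (-y x) x) ∧ Tendsto J atTop (𝓝 0) := by
  have hd : ∀ x, HasDerivAt (fun T => ∫ t in (0:ℝ)..T, y t) (y x) x := fun x =>
    hy.integral_hasStrictDerivAt 0 x |>.hasDerivAt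
  have hmono : Monotone (fun T => ∫ t in (0:ℝ)..T, y t) :=
    monotone_of_hasDerivAt_nonneg hd fun x => (hy0 x).le
  have hbdd : BddAbove (range fun T => ∫ t in (0:ℝ)..T, y t) := by
    refine ⟨B, ?_⟩
    rintro _ ⟨T, rfl⟩
    exact (hmono (le_max_left T X)).trans (hB _ (le_max_right T X))
  refine ⟨fun x => (⨆ T, ∫ t in (0:ℝ)..T, y t) - ∫ t in (0:ℝ)..x, y t, fun x => ?_, ?_⟩
  · exact (hd x).const_sub _
  · simpa using (tendsto_atTop_ciSup hmono hbdd).const_sub (⨆ T, ∫ t in (0:ℝ)..T, y t)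

lemma exists_exp_bound_of_geometric {F : ℝ → ℝ} {X B r d : ℝ} (hd : 0 < d) (hB : 0 < B)
    (hr : 0 < r) (hr1 : r < 1) (hFB : ∀ x, F x ≤ B)
    (hF : ∀ n : ℕ, ∀ x, X + n * d ≤ x → F x ≤ r ^ n * B) :
    ∃ C > (0:ℝ), ∃ lam > (0:ℝ), ∀ x, F x ≤ C * Real.exp (-lam * x) := by
  have hlog : Real.log r < 0 := Real.log_neg hr hr1
  have hlam : 0 < -Real.log r / d := div_pos (neg_pos.2 hlog) hd
  refine ⟨B * Real.exp (-Real.log r / d * (X + d)), by positivity, -Real.log r / d, hlam,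
    fun x => ?_⟩
  rw [mul_assoc, ← Real.exp_add]
  set lam := -Real.log r / d with hlam_def
  have hlamd : lam * d = -Real.log r := by rw [hlam_def]; field_simp
  rcases lt_or_ge x X with hx | hx
  · refine (hFB x).trans (le_mul_of_one_le_right hB.le (Real.one_le_exp ?_))
    nlinarith
  · set n := ⌊(x - X) / d⌋₊
    have h0 : 0 ≤ (x - X) / d := div_nonneg (by linarith) hd.le
    have h1 : (n : ℝ) * d ≤ x - X := (le_div_iff₀ hd).1 (Nat.floor_le h0)
    have h2 : x - X < (n + 1) * d := (div_lt_iff₀ hd).1 (Nat.lt_floor_add_one _)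
    refine (hF n x (by linarith)).trans ?_
    rw [mul_comm]
    refine mul_le_mul_of_nonneg_left ?_ hB.le
    have : r ^ n = Real.exp (n * Real.log r) := by
      rw [Real.exp_nat_mul, Real.exp_log hr]
    rw [this]
    refine Real.exp_le_exp.2 ?_
    nlinarith

lemma nonpos_of_slow_decay {J : ℝ → ℝ} {X C lam d : ℝ} (hlam : 0 < lam) (hd : 0 < d)
    (hJ : ∀ x ≥ X, Real.exp (-(lam * d / 2)) * J x ≤ J (x + d))
    (hC : ∀ x ≥ X, J x ≤ C * Real.exp (-lam * x)) : J X ≤ 0 := by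
  set q := Real.exp (-(lam * d / 2)) with hq
  have hq0 : 0 < q := Real.exp_pos _
  have hq1 : q < 1 := Real.exp_lt_one_iff.2 (neg_lt_zero.2 (by positivity))
  have hiter : ∀ n : ℕ, q ^ n * J X ≤ J (X + n * d) := by
    intro n
    induction n with
    | zero => simp
    | succ n ih =>
      have h1 := hJ (X + n * d) (le_add_of_nonneg_right (by positivity))
      have h2 := mul_le_mul_of_nonneg_left ih hq0.le
      calc q ^ (n + 1) * J X = q * (q ^ n * J X) := by ring
        _ ≤ J (X + n * d + d) := h2.trans h1
        _ = J (X + (n + 1 : ℕ) * d) := by push_cast; ring_nf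
  have hle : ∀ n : ℕ, J X ≤ C * Real.exp (-lam * X) * q ^ n := by
    intro n
    have h1 := (hiter n).trans (hC (X + n * d) (le_add_of_nonneg_right (by positivity)))
    have h2 : Real.exp (-lam * (X + n * d)) = Real.exp (-lam * X) * (q ^ n * q ^ n) := by
      rw [hq, ← Real.exp_nat_mul, ← Real.exp_add, ← Real.exp_add]; ring_nf
    rw [h2] at h1
    have h3 : q ^ n * J X ≤ q ^ n * (C * Real.exp (-lam * X) * q ^ n) := by linarith
    exact le_of_mul_le_mul_left h3 (pow_pos hq0 n)
  have hlim : Tendsto (fun n : ℕ => C * Real.exp (-lam * X) * q ^ n) atTop (𝓝 0) := by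
    simpa using (tendsto_pow_atTop_nhds_zero_of_lt_one hq0.le hq1).const_mul
      (C * Real.exp (-lam * X))
  exact ge_of_tendsto' hlim hle

lemma exists_tail_primitive_of_exp_bound {y : ℝ → ℝ} (hy : Continuous y) (hy0 : ∀ x, 0 < y x)
    {C lam : ℝ} (hC : 0 < C) (hlam : 0 < lam) (hb : ∀ x ≥ 0, y x ≤ C * Real.exp (-lam * x)) :
    ∃ J : ℝ → ℝ, (∀ x, HasDerivAt J (-y x) x) ∧ Tendsto J atTop (𝓝 0) ∧
      ∀ x ≥ 0, J x ≤ C / lam * Real.exp (-lam * x) := by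
  have hE : ∀ x, HasDerivAt (fun x => C / lam * Real.exp (-lam * x))
      (-(C * Real.exp (-lam * x))) x := by
    intro x
    have := ((((hasDerivAt_id x).const_mul (-lam)).exp).const_mul (C / lam))
    refine this.congr_deriv ?_
    simp only [id]
    field_simp
  have hElim : Tendsto (fun x => C / lam * Real.exp (-lam * x)) atTop (𝓝 0) := by
    have : Tendsto (fun x => -lam * x) atTop atBot :=
      tendsto_id.const_mul_atTop_of_neg (neg_lt_zero.2 hlam)
    simpa using (Real.tendsto_exp_atBot.comp this).const_mul (C / lam)
  have hd : ∀ x, HasDerivAt (fun T => ∫ t in (0:ℝ)..T, y t) (y x) x := fun x =>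
    (hy.integral_hasStrictDerivAt 0 x).hasDerivAt
  obtain ⟨J, hJ, hJlim⟩ := exists_tail_primitive hy hy0 (X := 0) (B := C / lam) fun T hT => by
    have hanti : AntitoneOn (fun x => (∫ t in (0:ℝ)..x, y t) + C / lam * Real.exp (-lam * x))
        (Ici 0) := by
      have hsum := fun x => (hd x).add (hE x)
      refine antitoneOn_of_deriv_nonpos (convex_Ici 0)
        (fun x _ => (hsum x).continuousAt.continuousWithinAt)
        (fun x _ => (hsum x).differentiableAt.differentiableWithinAt) fun x hx => ?_
      have := hb x (interior_subset hx)
      exact ((hsum x).deriv).trans_le (by linarith)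
    have h1 := hanti self_mem_Ici hT hT
    have h2 : 0 < C / lam * Real.exp (-lam * T) := by positivity
    simp only [intervalIntegral.integral_same, mul_zero, Real.exp_zero, mul_one, zero_add] at h1
    linarith
  refine ⟨J, hJ, hJlim, fun x hx => ?_⟩
  have := nonneg_of_deriv_nonpos_of_tendsto_zero (fun x => (hE x).fun_sub (hJ x)) (X := 0)
    (fun x hx => by linarith [hb x hx]) (by simpa using hElim.sub hJlim) x hx
  simpa using this

namespace IsAvgWeight

variable {h : ℝ} {w y : ℝ → ℝ}

lemma le_avg_of_monotone (hk : IsAvgWeight h w) {Y : ℝ → ℝ} (hYc : Continuous Y)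
    (hY : Monotone Y) (x : ℝ) : Y x ≤ avg h w Y x :=
  hk.le_avg_of_le hYc fun _ hs => hY (by linarith [hs.1])

lemma avg_le_of_monotone (hk : IsAvgWeight h w) {Y : ℝ → ℝ} (hYc : Continuous Y)
    (hY : Monotone Y) (x : ℝ) : avg h w Y x ≤ Y (x + h) :=
  hk.avg_le_of_le hYc fun _ hs => hY (by linarith [hs.2])

lemma le_avg_of_antitone (hk : IsAvgWeight h w) {Y : ℝ → ℝ} (hYc : Continuous Y)
    (hY : Antitone Y) (x : ℝ) : Y (x + h) ≤ avg h w Y x :=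
  hk.le_avg_of_le hYc fun _ hs => hY (by linarith [hs.2])

lemma avg_le_of_antitone (hk : IsAvgWeight h w) {Y : ℝ → ℝ} (hYc : Continuous Y)
    (hY : Antitone Y) (x : ℝ) : avg h w Y x ≤ Y x :=
  hk.avg_le_of_le hYc fun _ hs => hY (by linarith [hs.1])

lemma tendsto_avg_of_antitone (hk : IsAvgWeight h w) {Y : ℝ → ℝ} (hYc : Continuous Y)
    (hY : Antitone Y) (hlim : Tendsto Y atTop (𝓝 0)) : Tendsto (avg h w Y) atTop (𝓝 0) :=
  tendsto_of_tendsto_of_tendsto_of_le_of_le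
    (hlim.comp (tendsto_atTop_add_const_right _ h tendsto_id)) hlim
    (hk.le_avg_of_antitone hYc hY) (hk.avg_le_of_antitone hYc hY)

/-- If `y` eventually dominates a multiple `κ > 1` of its forward average, it decays
exponentially at `+∞`. -/
lemma exp_decay_atTop (hk : IsAvgWeight h w) {M : ℝ} (hM : ∀ s, w s ≤ M) (hy : Continuous y)
    (hy0 : ∀ x, 0 < y x) (hy1 : ∀ x, y x ≤ 1) {κ K X : ℝ} (hκ : 1 < κ)
    (hlow : ∀ x ≥ X, κ * avg h w y x ≤ y x) (hup : ∀ x ≥ X, y x ≤ K * avg h w y x) :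
    ∃ C > (0:ℝ), ∃ lam > (0:ℝ), ∀ x, y x ≤ C * Real.exp (-lam * x) := by
  have hh := hk.length_pos
  have hyabs : ∀ x, |y x| ≤ 1 := fun x => by rw [abs_of_pos (hy0 x)]; exact hy1 x
  have hpos : ∀ x, 0 < avg h w y x := fun x => hk.avg_pos hy (fun t => (hy0 t).le) (hy0 x)
  have hd : ∀ x, HasDerivAt (fun T => ∫ t in (0:ℝ)..T, y t) (y x) x := fun x =>
    (hy.integral_hasStrictDerivAt 0 x).hasDerivAt
  obtain ⟨J, hJ, hJlim⟩ : ∃ J : ℝ → ℝ, (∀ x, HasDerivAt J (-y x) x) ∧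
      Tendsto J atTop (𝓝 0) := by
    set Y := fun T => ∫ t in (0:ℝ)..T, y t with hY
    have hYc : Continuous Y := continuous_iff_continuousAt.2 fun x => (hd x).continuousAt
    have hYm : Monotone Y := monotone_of_hasDerivAt_nonneg hd fun x => (hy0 x).le
    refine exists_tail_primitive hy hy0 (X := X)
      (B := (κ * avg h w Y X - Y X) / (κ - 1)) fun T hT => ?_
    have hsum := fun x => (hd x).sub ((hk.hasDerivAt_avg hd hy hyabs x).const_mul κ)
    have hmono : MonotoneOn (fun x => Y x - κ * avg h w Y x) (Ici X) := by
      refine monotoneOn_of_deriv_nonneg (convex_Ici X)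
        (fun x _ => (hsum x).continuousAt.continuousWithinAt)
        (fun x _ => (hsum x).differentiableAt.differentiableWithinAt) fun x hx => ?_
      have := hlow x (interior_subset hx)
      exact (sub_nonneg.2 this).trans_eq ((hsum x).deriv).symm
    have h1 := hmono self_mem_Ici hT hT
    have h2 := hk.le_avg_of_monotone hYc hYm T
    rw [le_div_iff₀ (by linarith)]
    simp only at h1
    change Y T * (κ - 1) ≤ _
    nlinarith
  have hJc : Continuous J := continuous_iff_continuousAt.2 fun x => (hJ x).continuousAt
  have hJa : Antitone J :=
    (strictAnti_of_hasDerivAt_neg hJ fun x => neg_lt_zero.2 (hy0 x)).antitone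
  have hJ0 : ∀ x, 0 ≤ J x := fun x => le_of_tendsto hJlim <| by
    filter_upwards [eventually_ge_atTop x] with t ht using hJa ht
  have hJavg : ∀ x, HasDerivAt (avg h w J) (-avg h w y x) x := by
    intro x
    refine (hk.hasDerivAt_avg hJ hy.neg (B := 1) (by simpa using hyabs) x).congr_deriv ?_
    simp [avg]
  have hJstep : ∀ x ≥ X, J (x + h) ≤ κ⁻¹ * J x := by
    intro x hx
    have h1 := nonneg_of_deriv_nonpos_of_tendsto_zero
      (fun x => (hJ x).fun_sub ((hJavg x).const_mul κ)) (X := X)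
      (fun x hx => by linarith [hlow x hx])
      (by simpa using hJlim.sub ((hk.tendsto_avg_of_antitone hJc hJa hJlim).const_mul κ)) x hx
    have h2 := hk.le_avg_of_antitone hJc hJa x
    rw [le_inv_mul_iff₀ (by linarith)]
    nlinarith
  have hJgeo : ∀ n : ℕ, ∀ x, X + n * h ≤ x → J x ≤ κ⁻¹ ^ n * J X := by
    intro n
    induction n with
    | zero => intro x hx; simpa using hJa (by simpa using hx)
    | succ n ih =>
      intro x hx
      push_cast at hx
      have h1 := hJstep (x - h) (by nlinarith [mul_nonneg (Nat.cast_nonneg (α := ℝ) n) hh.le])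
      rw [sub_add_cancel] at h1
      calc J x ≤ κ⁻¹ * J (x - h) := h1
        _ ≤ κ⁻¹ * (κ⁻¹ ^ n * J X) :=
          mul_le_mul_of_nonneg_left (ih _ (by linarith)) (by positivity)
        _ = κ⁻¹ ^ (n + 1) * J X := by ring
  have hM0 : 0 ≤ M := (hk.nonneg 0).trans (hM 0)
  have hK0 : 0 ≤ K := by
    by_contra! hK
    nlinarith [hup X le_rfl, hpos X, hy0 X]
  have hyJ : ∀ x ≥ X, y x ≤ K * (M * J x) := by
    intro x hx
    refine (hup x hx).trans (mul_le_mul_of_nonneg_left ?_ hK0)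
    have h1 : avg h w y x ≤ ∫ s in (0:ℝ)..h, y (x + s) * M :=
      intervalIntegral.integral_mono_on hh.le (hk.intervalIntegrable_mul hy x)
        (Continuous.intervalIntegrable (by fun_prop) _ _)
        fun s _ => mul_le_mul_of_nonneg_left (hM s) (hy0 _).le
    have h2 : ∫ s in (0:ℝ)..h, y (x + s) = J x - J (x + h) := by
      have := intervalIntegral.integral_eq_sub_of_hasDerivAt (a := 0) (b := h)
        (f := fun s => -J (x + s)) (f' := fun s => y (x + s))
        (fun s _ => by simpa using ((hJ (x + s)).comp_const_add x s).fun_neg)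
        (Continuous.intervalIntegrable (by fun_prop) _ _)
      rw [this]; simp; ring
    rw [intervalIntegral.integral_mul_const, h2] at h1
    nlinarith [hJ0 (x + h)]
  refine exists_exp_bound_of_geometric (r := κ⁻¹) (d := h) (X := X)
    (B := max 1 (K * (M * J X))) hh (by positivity) (by positivity)
    (inv_lt_one_of_one_lt₀ hκ) (fun x => (hy1 x).trans (le_max_left _ _)) fun n x hx => ?_
  have hxX : X ≤ x := le_trans (le_add_of_nonneg_right (by positivity)) hx
  calc y x ≤ K * (M * J x) := hyJ x hxX
    _ ≤ K * (M * (κ⁻¹ ^ n * J X)) := by gcongr; exact hJgeo n x hx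
    _ = κ⁻¹ ^ n * (K * (M * J X)) := by ring
    _ ≤ _ := by gcongr; exact le_max_right _ _

/-- If `y` is asymptotically dominated by its forward average, it does not decay exponentially
at `+∞`. -/
lemma not_exp_decay_atTop (hk : IsAvgWeight h w) (hy : Continuous y)
    (hy0 : ∀ x, 0 < y x) (hy1 : ∀ x, y x ≤ 1)
    (hup : ∀ η > 0, ∀ᶠ x in atTop, y x ≤ (1 + η) * avg h w y x) :
    ¬ ∃ C > (0:ℝ), ∃ lam > (0:ℝ), ∀ x ≥ (0:ℝ), y x ≤ C * Real.exp (-lam * x) := by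
  rintro ⟨C, hC, lam, hlam, hb⟩
  have hh := hk.length_pos
  have hyabs : ∀ x, |y x| ≤ 1 := fun x => by rw [abs_of_pos (hy0 x)]; exact hy1 x
  obtain ⟨J, hJ, hJlim, hJb⟩ := exists_tail_primitive_of_exp_bound hy hy0 hC hlam hb
  have hJc : Continuous J := continuous_iff_continuousAt.2 fun x => (hJ x).continuousAt
  have hJs : StrictAnti J := strictAnti_of_hasDerivAt_neg hJ fun x => neg_lt_zero.2 (hy0 x)
  have hJ0 : ∀ x, 0 < J x := fun x => (le_of_tendsto hJlim <| by
    filter_upwards [eventually_ge_atTop (x + 1)] with t ht using hJs.antitone ht).trans_lt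
      (hJs (lt_add_one x))
  have hJavg : ∀ x, HasDerivAt (avg h w J) (-avg h w y x) x := by
    intro x
    refine (hk.hasDerivAt_avg hJ hy.neg (B := 1) (by simpa using hyabs) x).congr_deriv ?_
    simp [avg]
  obtain ⟨θ, hθ, hθ1, hsplit⟩ := hk.exists_half_split
  set q := Real.exp (-(lam * (h / 2) / 2)) with hq
  have hq1 : q < 1 := Real.exp_lt_one_iff.2 (neg_lt_zero.2 (by positivity))
  have hη : 0 < θ * (1 - q) := mul_pos hθ (by linarith)
  obtain ⟨X, hX⟩ := eventually_atTop.1 (hup _ hη)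
  refine (hJ0 (max X 0)).not_ge (nonpos_of_slow_decay (C := C / lam) hlam (half_pos hh) ?_
    fun x hx => hJb x ((le_max_right _ _).trans hx))
  intro x hx
  have h1 := nonneg_of_deriv_nonpos_of_tendsto_zero
    (fun x => ((hJavg x).const_mul (1 + θ * (1 - q))).fun_sub (hJ x)) (X := X)
    (fun x hx => by linarith [hX x hx])
    (by simpa using ((hk.tendsto_avg_of_antitone hJc hJs.antitone hJlim).const_mul
      (1 + θ * (1 - q))).sub hJlim) x ((le_max_left _ _).trans hx)
  have h2 := hsplit (fun x => -J x) hJc.neg hJs.antitone.neg x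
  have h3 : avg h w (fun x => -J x) x = -avg h w J x := by simp [avg]
  rw [h3] at h2
  by_contra! hlt
  have h4 : avg h w J x < (1 - θ * (1 - q)) * J x := by nlinarith
  have h5 := hJ0 x
  nlinarith [mul_lt_mul_of_pos_left h4 (by linarith : 0 < 1 + θ * (1 - q)),
    mul_pos (pow_pos hη 2) h5]

/-- If `y` is eventually dominated by a multiple `r < 1` of its forward average, it decays
exponentially at `-∞`. -/
lemma exp_decay_atBot (hk : IsAvgWeight h w) (hy : Continuous y)
    (hy1 : ∀ x, y x ≤ 1) {r X : ℝ} (hr : 0 < r) (hr1 : r < 1)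
    (hup : ∀ x ≤ X, y x ≤ r * avg h w y x) :
    ∃ C > (0:ℝ), ∃ lam > (0:ℝ), ∀ x, y x ≤ C * Real.exp (lam * x) := by
  have hh := hk.length_pos
  have hgeo : ∀ n : ℕ, ∀ x, x ≤ X - n * h → y x ≤ r ^ n := by
    intro n
    induction n with
    | zero => intro x _; simpa using hy1 x
    | succ n ih =>
      intro x hx
      push_cast at hx
      have hnh : 0 ≤ (n : ℝ) * h := by positivity
      calc y x ≤ r * avg h w y x := hup x (by linarith)
        _ ≤ r * r ^ n := mul_le_mul_of_nonneg_left
          (hk.avg_le_of_le hy fun s hs => ih _ (by linarith [hs.2])) hr.le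
        _ = r ^ (n + 1) := by ring
  obtain ⟨C, hC, lam, hlam, hb⟩ := exists_exp_bound_of_geometric (F := fun x => y (-x)) (X := -X)
    (B := 1) (r := r) (d := h) hh one_pos hr hr1 (fun x => hy1 _)
    fun n x hx => by simpa using hgeo n (-x) (by linarith)
  exact ⟨C, hC, lam, hlam, fun x => by simpa using hb (-x)⟩

/-- If `y` asymptotically dominates its forward average, it does not decay exponentially
at `-∞`. -/
lemma not_exp_decay_atBot (hk : IsAvgWeight h w) (hy : Continuous y)
    (hy0 : ∀ x, 0 < y x) (hy1 : ∀ x, y x ≤ 1)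
    (hlow : ∀ η > 0, ∀ᶠ x in atBot, (1 - η) * avg h w y x ≤ y x) :
    ¬ ∃ C > (0:ℝ), ∃ lam > (0:ℝ), ∀ x ≤ (0:ℝ), y x ≤ C * Real.exp (lam * x) := by
  rintro ⟨C, hC, lam, hlam, hb⟩
  have hh := hk.length_pos
  have hyabs : ∀ x, |y x| ≤ 1 := fun x => by rw [abs_of_pos (hy0 x)]; exact hy1 x
  obtain ⟨J, hJ, hJlim, hJb⟩ := exists_tail_primitive_of_exp_bound (y := fun x => y (-x))
    (by fun_prop) (fun x => hy0 _) hC hlam fun x hx => by simpa using hb (-x) (by linarith)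
  set K := fun x => J (-x) with hKdef
  have hK : ∀ x, HasDerivAt K (y x) x := fun x => by
    simpa [Function.comp_def] using (hJ (-x)).scomp x (hasDerivAt_neg x)
  have hKlim : Tendsto K atBot (𝓝 0) := hJlim.comp tendsto_neg_atBot_atTop
  have hKc : Continuous K := continuous_iff_continuousAt.2 fun x => (hK x).continuousAt
  have hKs : StrictMono K := strictMono_of_hasDerivAt_pos hK hy0
  have hK0 : ∀ x, 0 < K x := fun x => (le_of_tendsto hKlim <| by
    filter_upwards [eventually_le_atBot (x - 1)] with t ht using hKs.monotone ht).trans_lt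
      (hKs (sub_one_lt x))
  have hKavg := hk.hasDerivAt_avg hK hy hyabs
  have hKavglim : Tendsto (avg h w K) atBot (𝓝 0) :=
    tendsto_of_tendsto_of_tendsto_of_le_of_le hKlim
      (hKlim.comp (tendsto_atBot_add_const_right _ h tendsto_id))
      (hk.le_avg_of_monotone hKc hKs.monotone) (hk.avg_le_of_monotone hKc hKs.monotone)
  obtain ⟨θ, hθ, hθ1, hsplit⟩ := hk.exists_half_split
  set q := Real.exp (-(lam * (h / 2) / 2)) with hq
  have hq0 : 0 < q := Real.exp_pos _
  have hq1 : q < 1 := Real.exp_lt_one_iff.2 (neg_lt_zero.2 (by positivity))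
  have hη : 0 < θ * (1 - q) := mul_pos hθ (by linarith)
  have hη1 : θ * (1 - q) < 1 := by nlinarith
  obtain ⟨X, hX⟩ := eventually_atBot.1 (hlow _ hη)
  refine (hK0 (-max (-X) 0)).not_ge ?_
  simp only [hKdef, neg_neg]
  refine nonpos_of_slow_decay (C := C / lam) hlam (half_pos hh) ?_
    fun x hx => hJb x ((le_max_right _ _).trans hx)
  intro t ht
  obtain ⟨x, rfl⟩ : ∃ x, t = -x - h / 2 := ⟨-t - h / 2, by ring⟩
  have hxX : x ≤ X := by linarith [(le_max_left (-X) 0).trans ht]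
  have e1 : J (-x - h / 2) = K (x + h / 2) := by simp only [hKdef]; ring_nf
  have e2 : J (-x - h / 2 + h / 2) = K x := by simp only [hKdef]; ring_nf
  rw [e1, e2, ← hq]
  have h1 := nonneg_of_deriv_nonneg_of_tendsto_zero
    (fun x => (hK x).fun_sub ((hKavg x).const_mul (1 - θ * (1 - q)))) (X := X)
    (fun x hx => by linarith [hX x hx])
    (by simpa using hKlim.sub (hKavglim.const_mul (1 - θ * (1 - q)))) x hxX
  have h2 := hsplit K hKc hKs.monotone x
  have h3 : (1 - θ * (1 - q)) * ((1 - θ) * K x + θ * K (x + h / 2)) ≤ K x :=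
    (mul_le_mul_of_nonneg_left h2 (by linarith)).trans (by linarith)
  have h5 : 0 ≤ θ * (1 - q) * ((1 - q) * (1 - θ)) * K x :=
    mul_nonneg (mul_nonneg hη.le (mul_nonneg (by linarith) (by linarith))) (hK0 x).le
  have h6 : (1 - θ * (1 - q)) * θ * (q * K (x + h / 2) - K x) ≤ 0 := by nlinarith
  by_contra! hlt
  exact h6.not_gt (mul_pos (mul_pos (by linarith) hθ) (by linarith))

end IsAvgWeight

namespace IsAvgWeight

variable {h : ℝ} {w W : ℝ → ℝ}

/-- Linearization of the nonlocal equation `W · v (avg W) = ρ · v ρ` near the state `ρ`. -/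
lemma tendsto_ratio (hk : IsAvgWeight h w) {v : ℝ → ℝ} {ρ v' : ℝ} (hρ : 0 < ρ) (hvρ : 0 < v ρ)
    (hv : HasDerivAt v v' ρ) (hW : Continuous W) (hWrange : ∀ x, W x ∈ Icc (0:ℝ) 1)
    (heq : ∀ x, W x * v (avg h w W x) = ρ * v ρ) (hne : ∀ x, W x ≠ ρ)
    {l : Filter ℝ} [l.IsCountablyGenerated] (hl : ∀ s : ℝ, Tendsto (fun x => x + s) l l)
    (hlim : Tendsto W l (𝓝 ρ)) :
    Tendsto (fun x => |W x - ρ| / avg h w (fun t => |W t - ρ|) x) l (𝓝 (-(ρ * v') / v ρ)) := by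
  have hyc : Continuous fun t => |W t - ρ| := by fun_prop
  have hpos : ∀ x, 0 < avg h w (fun t => |W t - ρ|) x := fun x =>
    hk.avg_pos hyc (fun t => abs_nonneg _) (abs_pos.2 (sub_ne_zero.2 (hne x)))
  obtain ⟨σ, hσ⟩ : ∃ σ : ℝ, ∀ x, |W x - ρ| = σ * (W x - ρ) := by
    by_cases hall : ∀ x, W x ≤ ρ
    · exact ⟨-1, fun x => by rw [abs_of_nonpos (by linarith [hall x])]; ring⟩
    · push Not at hall
      refine ⟨1, fun x => ?_⟩
      rw [one_mul, abs_of_nonneg]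
      by_contra! hx
      obtain ⟨z, hz⟩ := mem_range_of_exists_le_of_exists_ge hW ⟨x, by linarith⟩
        (hall.imp fun _ => le_of_lt)
      exact hne z hz
  have havg : ∀ x, avg h w (fun t => |W t - ρ|) x = σ * (avg h w W x - ρ) := by
    intro x
    simp only [hσ]
    rw [avg_const_mul, hk.avg_sub_const hW]
  have hprod : ∀ x, σ * (avg h w W x - ρ) ≠ 0 := fun x => havg x ▸ (hpos x).ne'
  have hσ0 : σ ≠ 0 := left_ne_zero_of_mul (hprod 0)
  have hA0 : ∀ x, avg h w W x - ρ ≠ 0 := fun x => right_ne_zero_of_mul (hprod x)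
  have hA : Tendsto (avg h w W) l (𝓝 ρ) := hk.tendsto_avg hW (B := 1)
    (fun t => abs_le.2 ⟨by linarith [(hWrange t).1], (hWrange t).2⟩) hl hlim
  have hslope := (hasDerivAt_iff_tendsto_slope.1 hv).comp
    (tendsto_nhdsWithin_iff.2 ⟨hA, Eventually.of_forall fun x => sub_ne_zero.1 (hA0 x)⟩)
  have hvA : Tendsto (fun x => v (avg h w W x)) l (𝓝 (v ρ)) := hv.continuousAt.tendsto.comp hA
  have hmain := ((hvA.inv₀ hvρ.ne').const_mul (-ρ)).mul hslope
  have hval : -ρ * (v ρ)⁻¹ * v' = -(ρ * v') / v ρ := by field_simp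
  rw [hval] at hmain
  refine hmain.congr fun x => ?_
  have hvA0 : v (avg h w W x) ≠ 0 := fun h0 => by
    have := heq x
    rw [h0, mul_zero] at this
    exact (mul_pos hρ hvρ).ne this
  have hAx := hA0 x
  rw [havg, hσ, mul_div_mul_left _ _ hσ0, Function.comp_apply, slope_def_field]
  field_simp
  linarith [heq x]

lemma eq_zero_or_one_of_flux_eq_zero (hk : IsAvgWeight h w) {v : ℝ → ℝ}
    (hv : ∀ a ∈ Icc (0:ℝ) 1, v a = 0 → a = 1) (hW : Continuous W)
    (hWrange : ∀ x, W x ∈ Icc (0:ℝ) 1) (heq : ∀ x, W x * v (avg h w W x) = 0) (x : ℝ) :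
    W x = 0 ∨ W x = 1 := by
  refine (mul_eq_zero.1 (heq x)).imp_right fun h0 => ?_
  have h1 := hv _ ⟨hk.le_avg_of_le hW fun s _ => (hWrange _).1,
    hk.avg_le_of_le hW fun s _ => (hWrange _).2⟩ h0
  by_contra hne
  have h2 := hk.avg_pos (Q := fun t => -1 * (W t - 1)) (by fun_prop)
    (fun t => by linarith [(hWrange t).2]) (x := x)
    (by linarith [lt_of_le_of_ne (hWrange x).2 hne])
  rw [avg_const_mul, hk.avg_sub_const hW, h1] at h2
  linarith

end IsAvgWeight

/-- A nonconstant profile approaches only states in the open interval `(0,1)`. -/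
lemma mem_Ioo_of_tendsto {h : ℝ} {w W v : ℝ → ℝ} {ρ : ℝ} (hk : IsAvgWeight h w)
    (hvanti : StrictAntiOn v (Icc 0 1)) (hv1 : v 1 = 0)
    (hW : Continuous W) (hWrange : ∀ x, W x ∈ Icc (0:ℝ) 1)
    (heq : ∀ x, W x * v (avg h w W x) = ρ * v ρ) (hne : ∀ x, W x ≠ ρ)
    {l : Filter ℝ} [l.NeBot] (hlim : Tendsto W l (𝓝 ρ)) : ρ ∈ Ioo (0:ℝ) 1 := by
  have hmem : ρ ∈ Icc (0:ℝ) 1 := isClosed_Icc.mem_of_tendsto hlim (Eventually.of_forall hWrange)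
  have hone : (1:ℝ) ∈ Icc (0:ℝ) 1 := right_mem_Icc.2 zero_le_one
  have hbdry : ρ * v ρ ≠ 0 := by
    intro h0
    have h01 := hk.eq_zero_or_one_of_flux_eq_zero
      (fun a ha hva => hvanti.injOn ha hone (hva.trans hv1.symm)) hW hWrange
      fun x => (heq x).trans h0
    have hρ : ρ = 0 ∨ ρ = 1 := (mul_eq_zero.1 h0).imp_right fun hv0 =>
      hvanti.injOn hmem hone (hv0.trans hv1.symm)
    rcases hρ with rfl | rfl
    · have : W = fun _ => 1 := funext fun x => (h01 x).resolve_left (hne x)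
      rw [this] at hlim
      exact one_ne_zero (tendsto_nhds_unique tendsto_const_nhds hlim)
    · have : W = fun _ => 0 := funext fun x => (h01 x).resolve_right (hne x)
      rw [this] at hlim
      exact zero_ne_one (tendsto_nhds_unique tendsto_const_nhds hlim)
  exact ⟨hmem.1.lt_of_ne' (left_ne_zero_of_mul hbdry),
    hmem.2.lt_of_ne fun h1 => right_ne_zero_of_mul hbdry (h1 ▸ hv1)⟩

/-- The derivative of the flux `ρ ↦ ρ v(ρ)` is strictly decreasing on `(0,1)`. -/
lemma strictAntiOn_flux_deriv {v : ℝ → ℝ} (hv : ContDiffOn ℝ 2 v (Icc 0 1))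
    (hvanti : StrictAntiOn v (Icc 0 1)) (hv'neg : ∀ ρ ∈ Icc (0:ℝ) 1, deriv v ρ < 0)
    (hv''np : ∀ ρ ∈ Icc (0:ℝ) 1, deriv (deriv v) ρ ≤ 0) :
    StrictAntiOn (fun ρ => v ρ + ρ * deriv v ρ) (Ioo 0 1) := by
  have hv2 : ContDiffOn ℝ 1 (deriv v) (Ioo 0 1) :=
    ((hv.mono Ioo_subset_Icc_self).deriv_of_isOpen isOpen_Ioo (by norm_num))
  have hanti : AntitoneOn (deriv v) (Ioo 0 1) := by
    refine antitoneOn_of_deriv_nonpos (convex_Ioo 0 1) hv2.continuousOn ?_ ?_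
    · rw [interior_Ioo]; exact hv2.differentiableOn one_ne_zero
    · rw [interior_Ioo]; exact fun x hx => hv''np x (Ioo_subset_Icc_self hx)
  intro a ha b hb hab
  have h1 := hvanti (Ioo_subset_Icc_self ha) (Ioo_subset_Icc_self hb) hab
  have h2 := hanti ha hb hab.le
  have h3 := hv'neg b (Ioo_subset_Icc_self hb)
  have h4 := mul_le_mul_of_nonneg_left h2 ha.1.le
  have h5 := mul_lt_mul_of_neg_right hab h3
  dsimp only
  linarith

/-- **Lemma 2.1, asymptotic limits.** Let `W` be a C¹ solution of
`W(x)·v(A(W;x)) = f̄` with limits `ρ⁻`, `ρ⁺` at `∓∞` and `W' → 0`.  (i) If `W ≠ ρ⁺`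
everywhere, then `W` approaches `ρ⁺` at an exponential rate as `x → +∞` iff `ρ⁺ > ρ̂`.
(ii) If `W ≠ ρ⁻` everywhere, then `W` approaches `ρ⁻` at an exponential rate as
`x → −∞` iff `ρ⁻ < ρ̂`. -/
theorem stmt_3 (h : ℝ) (hh : 0 < h) (w : ℝ → ℝ)
    (hw_supp : ∀ x, x ∉ Ioo 0 h → w x = 0)
    (hw_cont : ContinuousOn w (Ioo 0 h))
    (hw_bdd : ∃ Mw, ∀ x, w x ≤ Mw)
    (hw_pos : ∀ x ∈ Ioo 0 h, 0 < w x)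
    (hw_anti : StrictAntiOn w (Ioo 0 h))
    (hw_int1 : (∫ s in (0:ℝ)..h, w s) = 1)
    (v : ℝ → ℝ) (hv : ContDiffOn ℝ 2 v (Icc 0 1))
    (hv0 : v 0 = 1) (hv1 : v 1 = 0)
    (hv'neg : ∀ ρ ∈ Icc (0:ℝ) 1, deriv v ρ < 0)
    (hv''np : ∀ ρ ∈ Icc (0:ℝ) 1, deriv (deriv v) ρ ≤ 0)
    (rhohat : ℝ) (hrhohat_mem : rhohat ∈ Ioo (0:ℝ) 1)
    (hrhohat_crit : deriv (fun ρ => ρ * v ρ) rhohat = 0)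
    (hrhohat_uniq : ∀ ρ ∈ Ioo (0:ℝ) 1, deriv (fun ρ => ρ * v ρ) ρ = 0 → ρ = rhohat)
    (fbar rhom rhop : ℝ) (hfbar : 0 ≤ fbar)
    (W : ℝ → ℝ) (hWrange : ∀ x, W x ∈ Icc (0:ℝ) 1)
    (hW : ContDiff ℝ 1 W)
    (heq : ∀ x, W x * v (avg h w W x) = fbar)
    (hlim_m : Tendsto W atBot (𝓝 rhom))
    (hlim_p : Tendsto W atTop (𝓝 rhop))
    (hlim_d : Tendsto (deriv W) atBot (𝓝 0) ∧ Tendsto (deriv W) atTop (𝓝 0))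
    (hfm : fbar = rhom * v rhom) (hfp : fbar = rhop * v rhop) :
    ((∀ x, W x ≠ rhop) →
      ((∃ C > (0:ℝ), ∃ lam > (0:ℝ), ∀ x ≥ (0:ℝ), |W x - rhop| ≤ C * Real.exp (-lam * x))
        ↔ rhohat < rhop)) ∧
    ((∀ x, W x ≠ rhom) →
      ((∃ C > (0:ℝ), ∃ lam > (0:ℝ), ∀ x ≤ (0:ℝ), |W x - rhom| ≤ C * Real.exp (lam * x))
        ↔ rhom < rhohat)) := by
  obtain ⟨M, hM⟩ := hw_bdd
  have hk : IsAvgWeight h w :=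
    { length_pos := hh
      intervalIntegrable := by
        by_contra hni
        rw [intervalIntegral.integral_undef hni] at hw_int1
        exact zero_ne_one hw_int1
      nonneg := fun s => by
        by_cases hs : s ∈ Ioo 0 h
        · exact (hw_pos s hs).le
        · exact (hw_supp s hs).ge
      pos := hw_pos
      integral_eq_one := hw_int1 }
  have hvanti : StrictAntiOn v (Icc 0 1) :=
    strictAntiOn_of_deriv_neg (convex_Icc 0 1) hv.continuousOn fun x hx =>
      hv'neg x (interior_subset hx)
  have hdiff : ∀ ρ ∈ Icc (0:ℝ) 1, HasDerivAt v (deriv v ρ) ρ := fun ρ hρ =>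
    (differentiableAt_of_deriv_ne_zero (hv'neg ρ hρ).ne).hasDerivAt
  have hflux := strictAntiOn_flux_deriv hv hvanti hv'neg hv''np
  have hcrit : v rhohat + rhohat * deriv v rhohat = 0 := by
    have := ((hasDerivAt_id rhohat).fun_mul
      (hdiff rhohat (Ioo_subset_Icc_self hrhohat_mem))).deriv
    simp only [id, one_mul] at this
    rw [← this, hrhohat_crit]
  have hvpos : ∀ ρ ∈ Ioo (0:ℝ) 1, 0 < v ρ := fun ρ hρ =>
    hv1 ▸ hvanti (Ioo_subset_Icc_self hρ) (right_mem_Icc.2 zero_le_one) hρ.2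
  have hκgt : ∀ ρ ∈ Ioo (0:ℝ) 1, (1 < -(ρ * deriv v ρ) / v ρ ↔ rhohat < ρ) := fun ρ hρ => by
    rw [one_lt_div (hvpos ρ hρ), ← hflux.lt_iff_gt hρ hrhohat_mem]
    rw [hcrit]
    constructor <;> intro <;> linarith
  have hκlt : ∀ ρ ∈ Ioo (0:ℝ) 1, (-(ρ * deriv v ρ) / v ρ < 1 ↔ ρ < rhohat) := fun ρ hρ => by
    rw [div_lt_one (hvpos ρ hρ), ← hflux.lt_iff_gt hrhohat_mem hρ]
    rw [hcrit]
    constructor <;> intro <;> linarith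
  have hWc : Continuous W := hW.continuous
  have hy1 : ∀ ρ ∈ Ioo (0:ℝ) 1, ∀ x, |W x - ρ| ≤ 1 := fun ρ hρ x => abs_le.2
    ⟨by linarith [(hWrange x).1, hρ.2], by linarith [(hWrange x).2, hρ.1]⟩
  constructor
  · intro hne
    have hy0 : ∀ x, 0 < |W x - rhop| := fun x => abs_pos.2 (sub_ne_zero.2 (hne x))
    have hyc : Continuous fun t => |W t - rhop| := by fun_prop
    have heqp := fun x => (heq x).trans hfp
    have hρ := mem_Ioo_of_tendsto hk hvanti hv1 hWc hWrange heqp hne hlim_p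
    have hratio := hk.tendsto_ratio hρ.1 (hvpos _ hρ) (hdiff _ (Ioo_subset_Icc_self hρ)) hWc
      hWrange heqp hne (fun s => tendsto_atTop_add_const_right _ s tendsto_id) hlim_p
    have hpos : ∀ x, 0 < avg h w (fun t => |W t - rhop|) x := fun x =>
      hk.avg_pos hyc (fun t => (hy0 t).le) (hy0 x)
    rw [← hκgt _ hρ]
    set κ := -(rhop * deriv v rhop) / v rhop
    constructor
    · contrapose!
      intro hκ
      have := hk.not_exp_decay_atTop hyc hy0 (hy1 _ hρ) fun η hη => by
        filter_upwards [hratio.eventually_lt_const (by linarith : κ < 1 + η)] with x hx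
        exact ((div_lt_iff₀ (hpos x)).1 hx).le
      push Not at this
      exact this
    · intro hκ
      obtain ⟨κ', hκ'1, hκ'⟩ := exists_between hκ
      obtain ⟨X, hX⟩ := eventually_atTop.1 ((hratio.eventually_const_lt hκ').and
        (hratio.eventually_lt_const (lt_add_one κ)))
      obtain ⟨C, hC, lam, hlam, hb⟩ := hk.exp_decay_atTop hM hyc hy0 (hy1 _ hρ) hκ'1
        (fun x hx => ((lt_div_iff₀ (hpos x)).1 (hX x hx).1).le)
        (fun x hx => ((div_lt_iff₀ (hpos x)).1 (hX x hx).2).le)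
      exact ⟨C, hC, lam, hlam, fun x _ => hb x⟩
  · intro hne
    have hy0 : ∀ x, 0 < |W x - rhom| := fun x => abs_pos.2 (sub_ne_zero.2 (hne x))
    have hyc : Continuous fun t => |W t - rhom| := by fun_prop
    have heqm := fun x => (heq x).trans hfm
    have hρ := mem_Ioo_of_tendsto hk hvanti hv1 hWc hWrange heqm hne hlim_m
    have hratio := hk.tendsto_ratio hρ.1 (hvpos _ hρ) (hdiff _ (Ioo_subset_Icc_self hρ)) hWc
      hWrange heqm hne (fun s => tendsto_atBot_add_const_right _ s tendsto_id) hlim_m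
    have hpos : ∀ x, 0 < avg h w (fun t => |W t - rhom|) x := fun x =>
      hk.avg_pos hyc (fun t => (hy0 t).le) (hy0 x)
    rw [← hκlt _ hρ]
    set κ := -(rhom * deriv v rhom) / v rhom
    constructor
    · contrapose!
      intro hκ
      have := hk.not_exp_decay_atBot hyc hy0 (hy1 _ hρ) fun η hη => by
        filter_upwards [hratio.eventually_const_lt (by linarith : 1 - η < κ)] with x hx
        exact ((lt_div_iff₀ (hpos x)).1 hx).le
      push Not at this
      exact this
    · intro hκ
      obtain ⟨r, hr, hr1⟩ := exists_between (max_lt hκ zero_lt_one)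
      obtain ⟨X, hX⟩ := eventually_atBot.1
        (hratio.eventually_lt_const ((le_max_left _ _).trans_lt hr))
      obtain ⟨C, hC, lam, hlam, hb⟩ := hk.exp_decay_atBot hyc (hy1 _ hρ)
        ((le_max_right _ _).trans_lt hr) hr1
        (fun x hx => ((div_lt_iff₀ (hpos x)).1 (hX x hx)).le)
      exact ⟨C, hC, lam, hlam, fun x _ => hb x⟩
end

section
/- (Existence and uniqueness of monotone profiles for constant road condition, Theorem 2.2.) Let ρ⁻, ρ⁺ ∈ (0,1) satisfy ρ⁻ < ρ̂ < ρ⁺ and ρ⁻·v(ρ⁻) = ρ⁺·v(ρ⁺) =: f̄. Then there exists a continuous, monotone nondecreasing function W : ℝ → [ρ⁻, ρ⁺] satisfying W(x)·v(A(W;x)) = f̄ for all x ∈ ℝ, with lim_{x→−∞} W(x) = ρ⁻ and lim_{x→+∞} W(x) = ρ⁺. Moreover this solution is unique up to horizontal shifts: if W₁ and W₂ are two such monotone solutions, then there exists c ∈ ℝ with W₂(x) = W₁(x + c) for all x ∈ ℝ. -/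
open Set Filter Topology MeasureTheory

/-- A continuous monotone nondecreasing stationary profile `W : ℝ → [ρ⁻,ρ⁺]` with
`W(x)·v(A(W;x)) = f̄` and limits `ρ⁻` at `−∞`, `ρ⁺` at `+∞`. -/
def IsMonotoneProfile (h : ℝ) (w v : ℝ → ℝ) (fbar rhom rhop : ℝ) (W : ℝ → ℝ) : Prop :=
  Continuous W ∧ Monotone W ∧ (∀ x, W x ∈ Set.Icc rhom rhop) ∧
  (∀ x, W x * v (avg h w W x) = fbar) ∧
  Filter.Tendsto W Filter.atBot (nhds rhom) ∧ Filter.Tendsto W Filter.atTop (nhds rhop)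

/-- A probability density on `(0, h)`, positive there and bounded by `M`. -/
structure IsAveragingKernel (h M : ℝ) (w : ℝ → ℝ) : Prop where
  pos_h : 0 < h
  nonneg : ∀ s, 0 ≤ w s
  le_bound : ∀ s, w s ≤ M
  pos : ∀ s ∈ Ioo 0 h, 0 < w s
  integral_eq_one : (∫ s in (0:ℝ)..h, w s) = 1

/-- All the integrals defining `avg h w Q` converge. -/
def AvgIntegrable (h : ℝ) (w Q : ℝ → ℝ) : Prop :=
  ∀ x, IntervalIntegrable (fun s => Q (x + s) * w s) volume 0 h

namespace AvgIntegrable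

variable {h : ℝ} {w P Q : ℝ → ℝ}

lemma sub (hP : AvgIntegrable h w P) (hQ : AvgIntegrable h w Q) :
    AvgIntegrable h w (fun x => P x - Q x) := fun x => by
  simpa only [sub_mul] using (hP x).sub (hQ x)

lemma const_mul (c : ℝ) (hP : AvgIntegrable h w P) :
    AvgIntegrable h w (fun x => c * P x) := fun x => by
  simpa only [mul_assoc] using (hP x).const_mul c

lemma comp_add (c : ℝ) (hP : AvgIntegrable h w P) :
    AvgIntegrable h w (fun x => P (x + c)) := fun x => by
  simpa only [add_right_comm] using hP (x + c)

lemma avg_sub (hP : AvgIntegrable h w P) (hQ : AvgIntegrable h w Q) (x : ℝ) :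
    avg h w (fun x => P x - Q x) x = avg h w P x - avg h w Q x := by
  simp only [avg, sub_mul]
  exact intervalIntegral.integral_sub (hP x) (hQ x)

end AvgIntegrable

lemma avg_const_mul (h : ℝ) (w P : ℝ → ℝ) (c x : ℝ) :
    avg h w (fun x => c * P x) x = c * avg h w P x := by
  simp only [avg, mul_assoc]
  exact intervalIntegral.integral_const_mul _ _

lemma avg_comp_add (h : ℝ) (w P : ℝ → ℝ) (c x : ℝ) :
    avg h w (fun x => P (x + c)) x = avg h w P (x + c) := by
  simp only [avg, add_right_comm]

namespace IsAveragingKernel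

variable {h M : ℝ} {w : ℝ → ℝ}

lemma intervalIntegrable (hk : IsAveragingKernel h M w) : IntervalIntegrable w volume 0 h := by
  by_contra hn
  have := hk.integral_eq_one
  rw [intervalIntegral.integral_undef hn] at this
  exact zero_ne_one this

lemma bound_pos (hk : IsAveragingKernel h M w) : 0 < M :=
  (hk.pos (h / 2) ⟨half_pos hk.pos_h, half_lt_self hk.pos_h⟩).trans_le (hk.le_bound _)

lemma avg_const (hk : IsAveragingKernel h M w) (c x : ℝ) : avg h w (fun _ => c) x = c := by
  simp [avg, hk.integral_eq_one]

lemma avgIntegrable_of_bdd (hk : IsAveragingKernel h M w) {Q : ℝ → ℝ} (hQ : Measurable Q)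
    (hb : ∀ x, ∃ C, ∀ s ∈ Icc 0 h, |Q (x + s)| ≤ C) : AvgIntegrable h w Q := by
  intro x
  obtain ⟨C, hC⟩ := hb x
  rw [intervalIntegrable_iff_integrableOn_Ioc_of_le hk.pos_h.le]
  have hw := (intervalIntegrable_iff_integrableOn_Ioc_of_le hk.pos_h.le).1 hk.intervalIntegrable
  refine Integrable.bdd_mul (c := C) hw
    (hQ.comp (measurable_const.add measurable_id)).aestronglyMeasurable ?_
  filter_upwards [ae_restrict_mem measurableSet_Ioc] with s hs
  exact hC s ⟨hs.1.le, hs.2⟩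

lemma avgIntegrable_of_monotone (hk : IsAveragingKernel h M w) {Q : ℝ → ℝ} (hQ : Monotone Q) :
    AvgIntegrable h w Q := by
  refine hk.avgIntegrable_of_bdd hQ.measurable fun x => ⟨max |Q x| |Q (x + h)|, fun s hs => ?_⟩
  exact abs_le_max_abs_abs (hQ (by linarith [hs.1])) (hQ (by linarith [hs.2]))

lemma avgIntegrable_of_antitone (hk : IsAveragingKernel h M w) {Q : ℝ → ℝ} (hQ : Antitone Q) :
    AvgIntegrable h w Q := by
  refine hk.avgIntegrable_of_bdd hQ.measurable fun x => ⟨max |Q (x + h)| |Q x|, fun s hs => ?_⟩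
  exact abs_le_max_abs_abs (hQ (by linarith [hs.2])) (hQ (by linarith [hs.1]))

lemma avgIntegrable_of_continuous (hk : IsAveragingKernel h M w) {Q : ℝ → ℝ}
    (hQ : Continuous Q) : AvgIntegrable h w Q := by
  refine hk.avgIntegrable_of_bdd hQ.measurable fun x => ?_
  obtain ⟨C, hC⟩ := (isCompact_Icc (a := (0 : ℝ)) (b := h)).exists_bound_of_continuousOn
    (f := fun s => Q (x + s)) (by fun_prop)
  exact ⟨C, hC⟩

lemma avg_mono (hk : IsAveragingKernel h M w) {P Q : ℝ → ℝ} (hP : AvgIntegrable h w P)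
    (hQ : AvgIntegrable h w Q) {x : ℝ} (hPQ : ∀ s ∈ Icc 0 h, P (x + s) ≤ Q (x + s)) :
    avg h w P x ≤ avg h w Q x :=
  intervalIntegral.integral_mono_on hk.pos_h.le (hP x) (hQ x) fun s hs =>
    mul_le_mul_of_nonneg_right (hPQ s hs) (hk.nonneg s)

lemma avgIntegrable_const (hk : IsAveragingKernel h M w) (c : ℝ) :
    AvgIntegrable h w (fun _ => c) := hk.avgIntegrable_of_continuous continuous_const

lemma avg_le_const (hk : IsAveragingKernel h M w) {Q : ℝ → ℝ} (hQ : AvgIntegrable h w Q)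
    {x c : ℝ} (hc : ∀ s ∈ Icc 0 h, Q (x + s) ≤ c) : avg h w Q x ≤ c := by
  simpa [hk.avg_const] using hk.avg_mono hQ (hk.avgIntegrable_const c) hc

lemma const_le_avg (hk : IsAveragingKernel h M w) {Q : ℝ → ℝ} (hQ : AvgIntegrable h w Q)
    {x c : ℝ} (hc : ∀ s ∈ Icc 0 h, c ≤ Q (x + s)) : c ≤ avg h w Q x := by
  simpa [hk.avg_const] using hk.avg_mono (hk.avgIntegrable_const c) hQ hc

lemma avg_le_split (hk : IsAveragingKernel h M w) {Q : ℝ → ℝ} (hQ : AvgIntegrable h w Q)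
    {x δ p q : ℝ} (hδ : 0 ≤ δ) (hδh : δ ≤ h) (hp : 0 ≤ p) (hq : 0 ≤ q)
    (hQp : ∀ s ∈ Icc 0 δ, Q (x + s) ≤ p) (hQq : ∀ s ∈ Icc δ h, Q (x + s) ≤ q) :
    avg h w Q x ≤ M * δ * p + q := by
  have hsub1 : uIcc 0 δ ⊆ uIcc 0 h := by
    rw [uIcc_of_le hδ, uIcc_of_le hk.pos_h.le]; exact Icc_subset_Icc_right hδh
  have hsub2 : uIcc δ h ⊆ uIcc 0 h := by
    rw [uIcc_of_le hδh, uIcc_of_le hk.pos_h.le]; exact Icc_subset_Icc_left hδ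
  have i1 := (hQ x).mono_set hsub1
  have i2 := (hQ x).mono_set hsub2
  have e1 : ∫ s in (0:ℝ)..δ, Q (x + s) * w s ≤ M * δ * p := by
    calc ∫ s in (0:ℝ)..δ, Q (x + s) * w s ≤ ∫ s in (0:ℝ)..δ, p * M := by
          refine intervalIntegral.integral_mono_on hδ i1 (by simp) fun s hs => ?_
          exact (mul_le_mul_of_nonneg_right (hQp s hs) (hk.nonneg s)).trans
            (mul_le_mul_of_nonneg_left (hk.le_bound s) hp)
      _ = M * δ * p := by rw [intervalIntegral.integral_const]; simp; ring
  have e2 : ∫ s in δ..h, Q (x + s) * w s ≤ q := by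
    calc ∫ s in δ..h, Q (x + s) * w s ≤ ∫ s in δ..h, q * w s := by
          refine intervalIntegral.integral_mono_on hδh i2
            ((hk.intervalIntegrable.mono_set hsub2).const_mul q) fun s hs => ?_
          exact mul_le_mul_of_nonneg_right (hQq s hs) (hk.nonneg s)
      _ = q * ∫ s in δ..h, w s := intervalIntegral.integral_const_mul _ _
      _ ≤ q * 1 := by
          refine mul_le_mul_of_nonneg_left ?_ hq
          rw [← hk.integral_eq_one, ← intervalIntegral.integral_add_adjacent_intervals
            (hk.intervalIntegrable.mono_set hsub1) (hk.intervalIntegrable.mono_set hsub2)]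
          linarith [intervalIntegral.integral_nonneg (μ := volume) hδ
            (fun s _ => hk.nonneg s)]
      _ = q := mul_one q
  have := intervalIntegral.integral_add_adjacent_intervals i1 i2
  unfold avg
  linarith

lemma avg_monotone (hk : IsAveragingKernel h M w) {Q : ℝ → ℝ} (hQ : Monotone Q) :
    Monotone (avg h w Q) := by
  intro x y hxy
  have hi := hk.avgIntegrable_of_monotone hQ
  have := hk.avg_mono (x := 0) (hi.comp_add x) (hi.comp_add y) fun s _ => hQ (by linarith)
  simpa [avg_comp_add] using this

lemma avg_sub_avg_le (hk : IsAveragingKernel h M w) {Q : ℝ → ℝ} (hQ : Monotone Q) {x y : ℝ}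
    (hxy : x ≤ y) : avg h w Q y - avg h w Q x ≤ M * (y - x) * (Q (y + h) - Q x) := by
  have hi := hk.avgIntegrable_of_monotone hQ
  have hint : ∀ a b : ℝ, IntervalIntegrable Q volume a b := fun a b =>
    hQ.monotoneOn _ |>.intervalIntegrable
  have hintc : ∀ c a b : ℝ, IntervalIntegrable (fun s => Q (c + s)) volume a b := fun c a b =>
    (Monotone.monotoneOn (fun s t hst => hQ (by linarith)) _).intervalIntegrable
  have step : avg h w Q y - avg h w Q x ≤ ∫ s in (0:ℝ)..h, M * (Q (y + s) - Q (x + s)) := by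
    unfold avg
    rw [← intervalIntegral.integral_sub (hi y) (hi x)]
    refine intervalIntegral.integral_mono_on hk.pos_h.le ((hi y).sub (hi x))
      (((hintc y _ _).sub (hintc x _ _)).const_mul M) fun s hs => ?_
    rw [← sub_mul, mul_comm]
    exact mul_le_mul_of_nonneg_right (hk.le_bound s) (sub_nonneg.2 (hQ (by linarith)))
  rw [intervalIntegral.integral_const_mul, intervalIntegral.integral_sub (hintc y _ _)
    (hintc x _ _), intervalIntegral.integral_comp_add_left, intervalIntegral.integral_comp_add_left,
    intervalIntegral.integral_interval_sub_interval_comm' (hint _ _) (hint _ _) (hint _ _)] at step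
  have b1 : ∫ s in (x + h)..(y + h), Q s ≤ (y - x) * Q (y + h) := by
    have := intervalIntegral.integral_mono_on (μ := volume) (by linarith : x + h ≤ y + h)
      (hint _ _) (intervalIntegrable_const (c := Q (y + h))) fun s hs => hQ hs.2
    simpa using this
  have b2 : (y - x) * Q x ≤ ∫ s in x..y, Q s := by
    have := intervalIntegral.integral_mono_on (μ := volume) hxy
      (intervalIntegrable_const (c := Q x)) (hint _ _) fun s hs => hQ hs.1
    simpa using this
  have hM := hk.bound_pos
  calc _ ≤ _ := step
    _ ≤ M * ((y - x) * Q (y + h) - (y - x) * Q x) := by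
        refine mul_le_mul_of_nonneg_left ?_ hM.le
        simp only [add_zero]
        linarith
    _ = _ := by ring

lemma tendsto_avg (hk : IsAveragingKernel h M w) {q : ℕ → ℝ → ℝ} {Q : ℝ → ℝ} {x C : ℝ}
    (hm : ∀ n, Measurable (q n)) (hb : ∀ n, ∀ s ∈ Icc 0 h, |q n (x + s)| ≤ C)
    (hl : ∀ y, Tendsto (fun n => q n y) atTop (𝓝 (Q y))) :
    Tendsto (fun n => avg h w (q n) x) atTop (𝓝 (avg h w Q x)) := by
  have hw := hk.intervalIntegrable
  refine intervalIntegral.tendsto_integral_filter_of_dominated_convergence (fun s => C * w s)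
    (Eventually.of_forall fun n => ?_) (Eventually.of_forall fun n => ?_) (hw.const_mul C) ?_
  · exact ((hm n).comp (measurable_const.add measurable_id)).aestronglyMeasurable.mul
      (intervalIntegrable_iff.1 hw).aestronglyMeasurable
  · refine Eventually.of_forall fun s hs => ?_
    rw [uIoc_of_le hk.pos_h.le] at hs
    rw [norm_mul, Real.norm_eq_abs, Real.norm_eq_abs, abs_of_nonneg (hk.nonneg s)]
    exact mul_le_mul_of_nonneg_right (hb n s ⟨hs.1.le, hs.2⟩) (hk.nonneg s)
  · exact Eventually.of_forall fun s _ => (hl (x + s)).mul_const (w s)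

lemma eq_zero_of_avg_eq_zero (hk : IsAveragingKernel h M w) {D : ℝ → ℝ} (hD : Continuous D)
    {x : ℝ} (h0 : ∀ s ∈ Icc 0 h, 0 ≤ D (x + s)) (ha : avg h w D x = 0) :
    ∀ s ∈ Icc 0 h, D (x + s) = 0 := by
  have hi := hk.avgIntegrable_of_continuous hD x
  have hne : (0 : ℝ) ≠ h := hk.pos_h.ne
  unfold avg at ha
  rw [intervalIntegral.integral_of_le hk.pos_h.le, integral_Ioc_eq_integral_Ioo,
    setIntegral_eq_zero_iff_of_nonneg_ae] at ha
  · have hc : Continuous fun s => D (x + s) := by fun_prop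
    have hz : EqOn (fun s => D (x + s)) (fun _ => 0) (Ioo 0 h) := by
      refine Measure.eqOn_open_of_ae_eq (μ := volume) ?_ isOpen_Ioo hc.continuousOn
        continuousOn_const
      filter_upwards [ha, ae_restrict_mem measurableSet_Ioo] with s hs hs'
      exact (mul_eq_zero.1 hs).resolve_right (hk.pos s hs').ne'
    have := hz.closure hc continuous_const
    rw [closure_Ioo hne] at this
    exact this
  · filter_upwards [ae_restrict_mem measurableSet_Ioo] with s hs
    exact mul_nonneg (h0 s ⟨hs.1.le, hs.2.le⟩) (hk.nonneg s)
  · exact ((intervalIntegrable_iff_integrableOn_Ioc_of_le hk.pos_h.le).1 hi).mono_set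
      Ioo_subset_Ioc_self

end IsAveragingKernel

lemma exists_subseq_tendsto_of_locally_lipschitz {q : ℕ → ℝ → ℝ}
    (hb : ∀ x, ∃ C, ∀ n, |q n x| ≤ C)
    (he : ∀ x, ∃ L, ∃ δ > 0, ∀ᶠ n in atTop, ∀ y, |y - x| < δ → |q n y - q n x| ≤ L * |y - x|) :
    ∃ φ : ℕ → ℕ, StrictMono φ ∧ ∃ Q : ℝ → ℝ, Continuous Q ∧
      ∀ x, Tendsto (fun n => q (φ n) x) atTop (𝓝 (Q x)) := by
  choose C hC using hb
  obtain ⟨ℓ, -, φ, hφ, hℓ⟩ :=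
    (isCompact_univ_pi fun r : ℚ => isCompact_Icc (a := -C r) (b := C r)).tendsto_subseq
      (x := fun n (r : ℚ) => q n r) fun n r _ => abs_le.1 (hC r n)
  rw [tendsto_pi_nhds] at hℓ
  have hlim : ∀ x, ∃ z, Tendsto (fun n => q (φ n) x) atTop (𝓝 z) := by
    intro x
    apply cauchySeq_tendsto_of_complete
    obtain ⟨L, δ, hδ, hL⟩ := he x
    rw [Metric.cauchySeq_iff]
    intro ε hε
    have hη : 0 < min δ (ε / (3 * (|L| + 1))) := lt_min hδ (by positivity)
    obtain ⟨r, hr1, hr2⟩ := exists_rat_btwn (lt_add_of_pos_right x hη)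
    have hrx : |(r : ℝ) - x| < min δ (ε / (3 * (|L| + 1))) := by
      rw [abs_of_pos (by linarith)]; linarith
    have hclose : ∀ᶠ n in atTop, |q (φ n) r - q (φ n) x| < ε / 3 := by
      filter_upwards [hφ.tendsto_atTop.eventually hL] with n hn
      have h1 := hn r (hrx.trans_le (min_le_left _ _))
      have h2 := hrx.trans_le (min_le_right _ _)
      rw [lt_div_iff₀ (by positivity)] at h2
      have h3 : L * |(r : ℝ) - x| ≤ |L| * |(r : ℝ) - x| :=
        mul_le_mul_of_nonneg_right (le_abs_self L) (abs_nonneg _)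
      by_cases h0 : |(r : ℝ) - x| = 0
      · rw [h0, mul_zero] at h1; linarith
      · have := lt_of_le_of_ne (abs_nonneg ((r : ℝ) - x)) (Ne.symm h0)
        nlinarith
    obtain ⟨N₁, hN₁⟩ := eventually_atTop.1 hclose
    obtain ⟨N₂, hN₂⟩ := Metric.cauchySeq_iff.1 (hℓ r).cauchySeq (ε / 3) (by linarith)
    refine ⟨max N₁ N₂, fun m hm n hn => ?_⟩
    have e1 := abs_lt.1 (hN₁ m ((le_max_left _ _).trans hm))
    have e2 := abs_lt.1 (hN₁ n ((le_max_left _ _).trans hn))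
    have e3 := hN₂ m ((le_max_right _ _).trans hm) n ((le_max_right _ _).trans hn)
    simp only [Function.comp_apply, Real.dist_eq] at e3
    rw [abs_lt] at e3
    rw [Real.dist_eq, abs_lt]
    constructor <;> linarith [e1.1, e1.2, e2.1, e2.2, e3.1, e3.2]
  choose Q hQ using hlim
  refine ⟨φ, hφ, Q, continuous_iff_continuousAt.2 fun x => ?_, hQ⟩
  obtain ⟨L, δ, hδ, hL⟩ := he x
  have hQL : ∀ y, |y - x| < δ → |Q y - Q x| ≤ L * |y - x| := fun y hy =>
    le_of_tendsto ((hQ y).sub (hQ x)).abs <| by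
      filter_upwards [hφ.tendsto_atTop.eventually hL] with n hn using hn y hy
  rw [ContinuousAt, tendsto_iff_dist_tendsto_zero]
  refine squeeze_zero' (Eventually.of_forall fun y => dist_nonneg) (g := fun y => L * |y - x|) ?_ ?_
  · filter_upwards [Metric.ball_mem_nhds x hδ] with y hy
    rw [Real.dist_eq]
    exact hQL y (by simpa [Real.dist_eq] using hy)
  · have : Continuous fun y => L * |y - x| := by fun_prop
    simpa using this.tendsto x

/-- An increasing response function on `[a, b]` with fixed points exactly at the endpoints,
lying below the diagonal in between, with slope `κ > 1` at `b`. -/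
structure IsResponse (a b K κ : ℝ) (F : ℝ → ℝ) : Prop where
  lt : a < b
  strictMonoOn : StrictMonoOn F (Icc a b)
  one_le : 1 ≤ K
  sub_le : ∀ x ∈ Icc a b, ∀ y ∈ Icc a b, x ≤ y → F y - F x ≤ K * (y - x)
  map_left : F a = a
  map_right : F b = b
  lt_self : ∀ x ∈ Ioo a b, F x < x
  hasDerivAt : HasDerivAt F κ b
  one_lt : 1 < κ

namespace IsResponse

variable {a b K κ : ℝ} {F : ℝ → ℝ}

lemma monotoneOn (hF : IsResponse a b K κ F) : MonotoneOn F (Icc a b) :=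
  hF.strictMonoOn.monotoneOn

lemma left_mem (hF : IsResponse a b K κ F) : a ∈ Icc a b := ⟨le_rfl, hF.lt.le⟩

lemma right_mem (hF : IsResponse a b K κ F) : b ∈ Icc a b := ⟨hF.lt.le, le_rfl⟩

lemma left_le (hF : IsResponse a b K κ F) {x : ℝ} (hx : x ∈ Icc a b) : a ≤ F x :=
  hF.map_left.symm.le.trans (hF.monotoneOn hF.left_mem hx hx.1)

lemma le_self (hF : IsResponse a b K κ F) {x : ℝ} (hx : x ∈ Icc a b) : F x ≤ x := by
  rcases hx.1.eq_or_lt with rfl | h1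
  · exact hF.map_left.le
  rcases hx.2.eq_or_lt with rfl | h2
  · exact hF.map_right.le
  exact (hF.lt_self x ⟨h1, h2⟩).le

lemma continuousOn (hF : IsResponse a b K κ F) : ContinuousOn F (Icc a b) := by
  have : LipschitzOnWith K.toNNReal F (Icc a b) := by
    refine LipschitzOnWith.of_le_add_mul' K fun x hx y hy => ?_
    rw [Real.dist_eq]
    rcases le_total x y with hxy | hxy
    · have := hF.monotoneOn hx hy hxy
      nlinarith [abs_nonneg (x - y), hF.one_le]
    · have := hF.sub_le y hy x hx hxy
      rw [abs_of_nonneg (by linarith)]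
      linarith
  exact this.continuousOn

end IsResponse

section Monotone

variable {h M a b K κ : ℝ} {w F W : ℝ → ℝ}

lemma IsAveragingKernel.avg_mem_Icc (hk : IsAveragingKernel h M w) (hW : Monotone W)
    (hab : ∀ x, W x ∈ Icc a b) (x : ℝ) : avg h w W x ∈ Icc a b :=
  ⟨hk.const_le_avg (hk.avgIntegrable_of_monotone hW) fun _ _ => (hab _).1,
    hk.avg_le_const (hk.avgIntegrable_of_monotone hW) fun _ _ => (hab _).2⟩

lemma IsAveragingKernel.avg_le_apply_add (hk : IsAveragingKernel h M w) (hW : Monotone W) (x : ℝ) :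
    avg h w W x ≤ W (x + h) :=
  hk.avg_le_const (hk.avgIntegrable_of_monotone hW) fun s hs => hW (by linarith [hs.2])

lemma IsAveragingKernel.apply_le_avg (hk : IsAveragingKernel h M w) (hW : Monotone W) (x : ℝ) :
    W x ≤ avg h w W x :=
  hk.const_le_avg (hk.avgIntegrable_of_monotone hW) fun s hs => hW (by linarith [hs.1])

lemma IsAveragingKernel.avg_const_sub (hk : IsAveragingKernel h M w) (hW : Monotone W) (c x : ℝ) :
    avg h w (fun y => c - W y) x = c - avg h w W x := by
  rw [(hk.avgIntegrable_const c).avg_sub (hk.avgIntegrable_of_monotone hW), hk.avg_const]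

/-- Going one small step to the left multiplies the distance to `b` by at most `2 * K`. -/
lemma sub_le_two_mul (hk : IsAveragingKernel h M w) (hF : IsResponse a b K κ F) (hW : Monotone W)
    (hab : ∀ x, W x ∈ Icc a b) {δ x : ℝ} (hδ : 0 ≤ δ) (hδh : δ ≤ h) (hδM : K * (M * δ) ≤ 1 / 2)
    (hx : W x = F (avg h w W x)) : b - W x ≤ 2 * K * (b - W (x + δ)) := by
  have h1 := hF.sub_le _ (hk.avg_mem_Icc hW hab x) b hF.right_mem (hk.avg_mem_Icc hW hab x).2
  rw [hF.map_right, ← hx, ← hk.avg_const_sub hW] at h1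
  have hanti : Antitone fun y => b - W y := fun y z hyz => sub_le_sub_left (hW hyz) b
  have h2 := hk.avg_le_split (hk.avgIntegrable_of_antitone hanti) hδ hδh (x := x)
    (sub_nonneg.2 (hab x).2) (sub_nonneg.2 (hab (x + δ)).2)
    (fun s hs => hanti (by linarith [hs.1])) (fun s hs => hanti (by linarith [hs.1]))
  have h3 := mul_le_mul_of_nonneg_left h2 (zero_le_one.trans hF.one_le)
  have h4 := mul_le_mul_of_nonneg_right hδM (sub_nonneg.2 (hab x).2)
  nlinarith

lemma exists_step (hk : IsAveragingKernel h M w) (hF : IsResponse a b K κ F) :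
    ∃ δ, 0 < δ ∧ δ ≤ h ∧ K * (M * δ) ≤ 1 / 2 := by
  have hM := hk.bound_pos
  have hK := zero_lt_one.trans_le hF.one_le
  refine ⟨min h (1 / (2 * (K * M))), lt_min hk.pos_h (by positivity), min_le_left _ _, ?_⟩
  calc K * (M * min h (1 / (2 * (K * M)))) ≤ K * (M * (1 / (2 * (K * M)))) := by
        gcongr; exact min_le_right _ _
    _ = 1 / 2 := by field_simp

lemma sub_le_pow_mul (hk : IsAveragingKernel h M w) (hF : IsResponse a b K κ F) (hW : Monotone W)
    (hab : ∀ x, W x ∈ Icc a b) {δ X : ℝ} (hδ : 0 < δ) (hδh : δ ≤ h) (hδM : K * (M * δ) ≤ 1 / 2)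
    (hX : ∀ x < X, W x = F (avg h w W x)) (k : ℕ) {x : ℝ} (hx : x + k * δ ≤ X) :
    b - W x ≤ (2 * K) ^ k * (b - W (x + k * δ)) := by
  have hK := hF.one_le
  induction k generalizing x with
  | zero => simp
  | succ k ih =>
    have e : x + δ + k * δ = x + (k + 1 : ℕ) * δ := by push_cast; ring
    have hkδ : 0 ≤ k * δ := by positivity
    have h1 := sub_le_two_mul hk hF hW hab hδ.le hδh hδM (hX x (by linarith))
    have h2 := ih (x := x + δ) (by linarith)
    rw [e] at h2
    have h3 := mul_le_mul_of_nonneg_left h2 (by linarith : 0 ≤ 2 * K)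
    calc b - W x ≤ _ := h1
      _ ≤ _ := h3
      _ = _ := by ring

lemma sub_le_of_eq (hk : IsAveragingKernel h M w) (hF : IsResponse a b K κ F) (hW : Monotone W)
    (hab : ∀ x, W x ∈ Icc a b) {x y : ℝ} (hxy : x ≤ y) (hx : W x = F (avg h w W x))
    (hy : W y = F (avg h w W y)) : W y - W x ≤ K * M * (y - x) * (b - W x) := by
  have h1 := hF.sub_le _ (hk.avg_mem_Icc hW hab x) _ (hk.avg_mem_Icc hW hab y)
    (hk.avg_monotone hW hxy)
  rw [← hx, ← hy] at h1
  have h2 := hk.avg_sub_avg_le hW hxy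
  have hM := hk.bound_pos
  have h3 : M * (y - x) * (W (y + h) - W x) ≤ M * (y - x) * (b - W x) := by
    have := (hab (y + h)).2
    have := mul_nonneg hM.le (sub_nonneg.2 hxy)
    gcongr
  calc W y - W x ≤ _ := h1
    _ ≤ K * (M * (y - x) * (b - W x)) :=
      mul_le_mul_of_nonneg_left (h2.trans h3) (zero_le_one.trans hF.one_le)
    _ = _ := by ring

lemma abs_sub_le_of_eq (hk : IsAveragingKernel h M w) (hF : IsResponse a b K κ F)
    (hW : Monotone W) (hab : ∀ x, W x ∈ Icc a b) {x y z : ℝ} (hzx : z ≤ x) (hzy : z ≤ y)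
    (hx : W x = F (avg h w W x)) (hy : W y = F (avg h w W y)) :
    |W y - W x| ≤ K * M * |y - x| * (b - W z) := by
  have hKM := mul_nonneg (zero_le_one.trans hF.one_le) hk.bound_pos.le
  rcases le_total x y with hxy | hxy
  · rw [abs_of_nonneg (sub_nonneg.2 (hW hxy)), abs_of_nonneg (sub_nonneg.2 hxy)]
    exact (sub_le_of_eq hk hF hW hab hxy hx hy).trans
      (mul_le_mul_of_nonneg_left (sub_le_sub_left (hW hzx) b)
        (mul_nonneg hKM (sub_nonneg.2 hxy)))
  · rw [abs_sub_comm, abs_sub_comm y, abs_of_nonneg (sub_nonneg.2 (hW hxy)),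
      abs_of_nonneg (sub_nonneg.2 hxy)]
    exact (sub_le_of_eq hk hF hW hab hxy hy hx).trans
      (mul_le_mul_of_nonneg_left (sub_le_sub_left (hW hzy) b)
        (mul_nonneg hKM (sub_nonneg.2 hxy)))

lemma eq_or_eq_of_tendsto (hk : IsAveragingKernel h M w) (hF : IsResponse a b K κ F)
    (hW : Monotone W) (hab : ∀ x, W x ∈ Icc a b) {l : Filter ℝ} [l.NeBot] {L : ℝ}
    (hL : Tendsto W l (𝓝 L)) (hLh : Tendsto (fun x => W (x + h)) l (𝓝 L))
    (he : ∀ᶠ x in l, W x = F (avg h w W x)) : L = a ∨ L = b := by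
  have hmem : L ∈ Icc a b := isClosed_Icc.mem_of_tendsto hL (Eventually.of_forall hab)
  have hA : Tendsto (avg h w W) l (𝓝[Icc a b] L) :=
    tendsto_nhdsWithin_iff.2 ⟨tendsto_of_tendsto_of_tendsto_of_le_of_le hL hLh
      (fun x => hk.apply_le_avg hW x) (fun x => hk.avg_le_apply_add hW x),
      Eventually.of_forall (hk.avg_mem_Icc hW hab)⟩
  have hFL : F L = L := tendsto_nhds_unique ((hF.continuousOn L hmem).tendsto.comp hA)
    (hL.congr' he)
  by_contra! hne
  exact (hF.lt_self L ⟨lt_of_le_of_ne hmem.1 hne.1.symm, lt_of_le_of_ne hmem.2 hne.2⟩).ne hFL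

lemma tendsto_atBot_left (hk : IsAveragingKernel h M w) (hF : IsResponse a b K κ F)
    (hW : Monotone W) (hab : ∀ x, W x ∈ Icc a b) {X : ℝ} (he : ∀ x < X, W x = F (avg h w W x))
    {x₀ : ℝ} (hx₀ : W x₀ < b) : Tendsto W atBot (𝓝 a) := by
  have hbdd : BddBelow (range W) := ⟨a, by rintro _ ⟨x, rfl⟩; exact (hab x).1⟩
  have hL := tendsto_atBot_ciInf hW hbdd
  rcases eq_or_eq_of_tendsto hk hF hW hab hL
    (hL.comp (tendsto_atBot_add_const_right _ h tendsto_id))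
    ((eventually_lt_atBot X).mono he) with h1 | h1
  · rwa [h1] at hL
  · exact absurd ((ciInf_le hbdd x₀).trans_lt hx₀) (by rw [h1]; exact lt_irrefl b)

lemma tendsto_atTop_right (hk : IsAveragingKernel h M w) (hF : IsResponse a b K κ F)
    (hW : Monotone W) (hab : ∀ x, W x ∈ Icc a b) (he : ∀ x, W x = F (avg h w W x))
    {x₀ : ℝ} (hx₀ : a < W x₀) : Tendsto W atTop (𝓝 b) := by
  have hbdd : BddAbove (range W) := ⟨b, by rintro _ ⟨x, rfl⟩; exact (hab x).2⟩
  have hL := tendsto_atTop_ciSup hW hbdd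
  rcases eq_or_eq_of_tendsto hk hF hW hab hL
    (hL.comp (tendsto_atTop_add_const_right _ h tendsto_id))
    (Eventually.of_forall he) with h1 | h1
  · exact absurd (hx₀.trans_le (le_ciSup hbdd x₀)) (by rw [h1]; exact lt_irrefl a)
  · rwa [h1] at hL

/-- The half-line problem with constant datum `c` on `[0, ∞)` has a monotone solution. -/
lemma exists_halfLine_solution (hk : IsAveragingKernel h M w) (hF : IsResponse a b K κ F) {c : ℝ}
    (hc : c ∈ Icc a b) : ∃ Q : ℝ → ℝ, Monotone Q ∧ (∀ x, Q x ∈ Icc a b) ∧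
      (∀ x < 0, Q x = F (avg h w Q x)) ∧ ∀ x, 0 ≤ x → Q x = c := by
  have : Fact (a ≤ c) := ⟨hc.1⟩
  have hsub : ∀ {x}, x ∈ Icc a c → x ∈ Icc a b := fun hx => ⟨hx.1, hx.2.trans hc.2⟩
  have hmono : ∀ Q : ℝ →o Icc a c, Monotone fun y => (Q y : ℝ) := fun Q x y hxy => Q.mono hxy
  have hA : ∀ (Q : ℝ →o Icc a c) x, avg h w (fun y => (Q y : ℝ)) x ∈ Icc a c := fun Q x =>
    hk.avg_mem_Icc (hmono Q) (fun y => (Q y).2) x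
  have hFA : ∀ (Q : ℝ →o Icc a c) x, F (avg h w (fun y => (Q y : ℝ)) x) ∈ Icc a c := fun Q x =>
    ⟨hF.left_le (hsub (hA Q x)), (hF.le_self (hsub (hA Q x))).trans (hA Q x).2⟩
  let T : (ℝ →o Icc a c) →o (ℝ →o Icc a c) :=
    { toFun := fun Q =>
        { toFun := fun x => if x < 0 then ⟨_, hFA Q x⟩ else ⟨c, hc.1, le_rfl⟩
          monotone' := by
            intro x y hxy
            dsimp only
            split_ifs with h1 h2 h2
            · exact hF.monotoneOn (hsub (hA Q x)) (hsub (hA Q y)) (hk.avg_monotone (hmono Q) hxy)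
            · exact (hFA Q x).2
            · linarith
            · exact le_rfl }
      monotone' := by
        intro P Q hPQ x
        change (if x < 0 then (⟨_, hFA P x⟩ : Icc a c) else ⟨c, hc.1, le_rfl⟩) ≤
          if x < 0 then ⟨_, hFA Q x⟩ else ⟨c, hc.1, le_rfl⟩
        split_ifs with h1
        · exact hF.monotoneOn (hsub (hA P x)) (hsub (hA Q x))
            (hk.avg_mono (hk.avgIntegrable_of_monotone (hmono P))
              (hk.avgIntegrable_of_monotone (hmono Q)) fun s _ => hPQ (x + s))
        · exact le_rfl }
  obtain ⟨p, hp⟩ : ∃ p, T p = p :=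
    ⟨OrderHom.lfp (α := ℝ →o Icc a c) T, OrderHom.map_lfp (α := ℝ →o Icc a c) T⟩
  have hfix : ∀ x, T p x = p x := fun x => by rw [hp]
  refine ⟨fun x => p x, hmono _, fun x => hsub (p x).2, fun x hx => ?_, fun x hx => ?_⟩
  · dsimp only
    rw [← hfix x]
    change ((if x < 0 then (⟨_, hFA p x⟩ : Icc a c) else ⟨c, hc.1, le_rfl⟩ : Icc a c) : ℝ) = _
    rw [if_pos hx]
  · dsimp only
    rw [← hfix x]
    change ((if x < 0 then (⟨_, hFA p x⟩ : Icc a c) else ⟨c, hc.1, le_rfl⟩ : Icc a c) : ℝ) = _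
    rw [if_neg hx.not_gt]

/-- Solutions on arbitrarily long left half-lines, normalised at the origin. -/
lemma exists_normalized_solution (hk : IsAveragingKernel h M w) (hF : IsResponse a b K κ F) {m : ℝ}
    (hm : m ∈ Ioo a b) (n : ℕ) : ∃ q : ℝ → ℝ, Monotone q ∧ (∀ x, q x ∈ Icc a b) ∧
      (∀ x < (n : ℝ), q x = F (avg h w q x)) ∧ q 0 = m := by
  obtain ⟨δ, hδ, hδh, hδM⟩ := exists_step hk hF
  have hK := hF.one_le
  have hKM := mul_nonneg (zero_le_one.trans hF.one_le) hk.bound_pos.le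
  obtain ⟨k, hk'⟩ := exists_nat_gt ((n : ℝ) / δ)
  rw [div_lt_iff₀ hδ] at hk'
  have hkδ : 0 < k * δ := n.cast_nonneg.trans_lt hk'
  have hpow : (1 : ℝ) ≤ (2 * K) ^ k := one_le_pow₀ (by linarith)
  set ε := (b - m) / (2 * (2 * K) ^ k) with hε
  have hbm : 0 < b - m := sub_pos.2 hm.2
  have hε0 : 0 < ε := by positivity
  have hεpow : (2 * K) ^ k * ε = (b - m) / 2 := by rw [hε]; field_simp
  have hεle : ε ≤ (b - m) / 2 := by nlinarith
  obtain ⟨Q, hQ, hQab, hQeq, hQc⟩ := exists_halfLine_solution hk hF (c := b - ε)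
    ⟨by linarith [hm.1], by linarith⟩
  have hQk : m < Q (-(k * δ)) := by
    have := sub_le_pow_mul hk hF hQ hQab hδ hδh hδM hQeq k (x := -(k * δ)) (by simp)
    rw [neg_add_cancel, hQc 0 le_rfl, sub_sub_cancel, hεpow] at this
    linarith
  have hbot := tendsto_atBot_left hk hF hQ hQab hQeq (x₀ := 0)
    (by rw [hQc 0 le_rfl]; linarith)
  obtain ⟨z, hz, hzk⟩ := ((hbot.eventually_lt_const hm.1).and
    (eventually_lt_atBot (-(k * δ)))).exists
  have hcont : ContinuousOn Q (Icc z (-(k * δ))) := by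
    intro x hx
    have : LipschitzOnWith (K * M * (b - a)).toNNReal Q (Icc z (-(k * δ))) := by
      refine LipschitzOnWith.of_dist_le_mul fun x hx y hy => ?_
      rw [Real.coe_toNNReal _ (mul_nonneg hKM (sub_nonneg.2 hF.lt.le)), Real.dist_eq, Real.dist_eq]
      have := abs_sub_le_of_eq hk hF hQ hQab hy.1 hx.1 (hQeq y (by linarith [hy.2]))
        (hQeq x (by linarith [hx.2]))
      calc |Q x - Q y| ≤ _ := this
        _ ≤ K * M * |x - y| * (b - a) := by
            have := (hQab z).1
            gcongr
        _ = _ := by ring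
    exact this.continuousOn x hx
  obtain ⟨t, ht, hQt⟩ := intermediate_value_Icc hzk.le hcont ⟨hz.le, hQk.le⟩
  refine ⟨fun x => Q (x + t), fun x y hxy => hQ (by linarith), fun x => hQab _, fun x hx => ?_,
    by simpa using hQt⟩
  rw [avg_comp_add]
  exact hQeq _ (by linarith [ht.2])

/-- A continuous monotone solution of `W = F(A(W))` on the line connecting `a` to `b`. -/
structure IsProfile (h a b : ℝ) (w F W : ℝ → ℝ) : Prop where
  continuous : Continuous W
  monotone : Monotone W
  mem_Icc : ∀ x, W x ∈ Icc a b
  eq_avg : ∀ x, W x = F (avg h w W x)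
  tendsto_atBot : Tendsto W atBot (𝓝 a)
  tendsto_atTop : Tendsto W atTop (𝓝 b)

lemma exists_profile (hk : IsAveragingKernel h M w) (hF : IsResponse a b K κ F) :
    ∃ W : ℝ → ℝ, IsProfile h a b w F W := by
  have hm : (a + b) / 2 ∈ Ioo a b := ⟨by linarith [hF.lt], by linarith [hF.lt]⟩
  choose q hq hqab hqeq hq0 using fun n => exists_normalized_solution hk hF hm n
  have hKM := mul_nonneg (zero_le_one.trans hF.one_le) hk.bound_pos.le
  have hbd : ∀ n x, |q n x| ≤ max |a| |b| := fun n x =>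
    abs_le_max_abs_abs (hqab n x).1 (hqab n x).2
  obtain ⟨φ, hφ, W, hWc, hW⟩ := exists_subseq_tendsto_of_locally_lipschitz
    (fun x => ⟨_, fun n => hbd n x⟩) (fun x => by
      refine ⟨K * M * (b - a), 1, one_pos, ?_⟩
      filter_upwards [tendsto_natCast_atTop_atTop.eventually_gt_atTop (x + 1)] with n hn y hy
      rw [abs_lt] at hy
      have := abs_sub_le_of_eq hk hF (hq n) (hqab n) (min_le_left x y) (min_le_right x y)
        (hqeq n x (by linarith)) (hqeq n y (by linarith [hy.2]))
      calc |q n y - q n x| ≤ _ := this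
        _ ≤ K * M * |y - x| * (b - a) := by
            have := (hqab n (min x y)).1
            gcongr
        _ = _ := by ring)
  have hWab : ∀ x, W x ∈ Icc a b := fun x =>
    isClosed_Icc.mem_of_tendsto (hW x) (Eventually.of_forall fun n => hqab _ x)
  have hWm : Monotone W := fun x y hxy => le_of_tendsto_of_tendsto' (hW x) (hW y) fun n =>
    hq _ hxy
  have hW0 : W 0 = (a + b) / 2 := tendsto_nhds_unique (hW 0) (by simp [hq0])
  have hWeq : ∀ x, W x = F (avg h w W x) := fun x => by
    have hA : Tendsto (fun n => avg h w (q (φ n)) x) atTop (𝓝[Icc a b] avg h w W x) :=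
      tendsto_nhdsWithin_iff.2 ⟨hk.tendsto_avg (fun n => (hq _).measurable)
        (fun n s _ => hbd _ _) hW, Eventually.of_forall fun n =>
          hk.avg_mem_Icc (hq _) (hqab _) x⟩
    refine tendsto_nhds_unique (hW x) ?_
    refine ((hF.continuousOn _ (hk.avg_mem_Icc hWm hWab x)).tendsto.comp hA).congr' ?_
    filter_upwards [hφ.tendsto_atTop.eventually
      (tendsto_natCast_atTop_atTop.eventually_gt_atTop x)] with n hn
    exact (hqeq _ x hn).symm
  exact ⟨W, hWc, hWm, hWab, hWeq,
    tendsto_atBot_left hk hF hWm hWab (X := 0) (fun x _ => hWeq x) (x₀ := 0)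
      (by rw [hW0]; exact hm.2),
    tendsto_atTop_right hk hF hWm hWab hWeq (x₀ := 0) (by rw [hW0]; exact hm.1)⟩

end Monotone

namespace IsProfile

variable {h M a b K κ : ℝ} {w F W P Q : ℝ → ℝ}

lemma comp_add (hW : IsProfile h a b w F W) (c : ℝ) :
    IsProfile h a b w F (fun x => W (x + c)) where
  continuous := hW.continuous.comp (continuous_id.add continuous_const)
  monotone := fun _ _ hxy => hW.monotone (add_le_add_left hxy c)
  mem_Icc := fun x => hW.mem_Icc (x + c)
  eq_avg := fun x => by rw [avg_comp_add]; exact hW.eq_avg (x + c)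
  tendsto_atBot := hW.tendsto_atBot.comp (tendsto_atBot_add_const_right _ c tendsto_id)
  tendsto_atTop := hW.tendsto_atTop.comp (tendsto_atTop_add_const_right _ c tendsto_id)

lemma le_of_le_Icc_step (hk : IsAveragingKernel h M w) (hF : IsResponse a b K κ F)
    (hP : IsProfile h a b w F P) (hQ : IsProfile h a b w F Q) {δ X : ℝ} (hδ : 0 < δ)
    (hδh : δ ≤ h) (hδM : K * (M * δ) ≤ 1 / 2) (hX : ∀ x ∈ Icc X (X + h), Q x ≤ P x) :
    ∀ x ∈ Icc (X - δ) (X + h), Q x ≤ P x := by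
  obtain ⟨x₀, hx₀, hmax⟩ := isCompact_Icc.exists_isMaxOn
    (nonempty_Icc.2 (by linarith : X - δ ≤ X)) (hQ.continuous.sub hP.continuous).continuousOn
  have hmax' : ∀ y ∈ Icc (X - δ) X, Q y - P y ≤ Q x₀ - P x₀ := fun y hy => hmax hy
  have hd : Q x₀ - P x₀ ≤ 0 := by
    by_contra! hd
    have hiQ := hk.avgIntegrable_of_monotone hQ.monotone
    have hiP := hk.avgIntegrable_of_monotone hP.monotone
    have havg := hk.avg_le_split (hiQ.sub hiP) hδ.le hδh (x := x₀) hd.le le_rfl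
      (fun s hs => by
        rcases le_or_gt (x₀ + s) X with hle | hgt
        · exact hmax' _ ⟨by linarith [hx₀.1, hs.1], hle⟩
        · exact (sub_nonpos.2 (hX _ ⟨hgt.le, by linarith [hx₀.2, hs.2]⟩)).trans hd.le)
      (fun s hs => sub_nonpos.2 (hX _ ⟨by linarith [hx₀.1, hs.1], by linarith [hx₀.2, hs.2]⟩))
    rw [hiQ.avg_sub hiP, add_zero] at havg
    have hAQ := hk.avg_mem_Icc hQ.monotone hQ.mem_Icc x₀
    have hAP := hk.avg_mem_Icc hP.monotone hP.mem_Icc x₀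
    rcases le_total (avg h w Q x₀) (avg h w P x₀) with hle | hle
    · have := hF.monotoneOn hAQ hAP hle
      rw [← hQ.eq_avg, ← hP.eq_avg] at this
      linarith
    · have h1 := hF.sub_le _ hAP _ hAQ hle
      rw [← hQ.eq_avg, ← hP.eq_avg] at h1
      have h2 := mul_le_mul_of_nonneg_left havg (zero_le_one.trans hF.one_le)
      have h3 := mul_le_mul_of_nonneg_right hδM hd.le
      linarith
  intro x hx
  rcases le_total x X with hle | hle
  · linarith [hmax' x ⟨hx.1, hle⟩]
  · exact hX x ⟨hle, hx.2⟩

/-- Backward comparison principle. -/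
lemma le_of_le_Icc (hk : IsAveragingKernel h M w) (hF : IsResponse a b K κ F)
    (hP : IsProfile h a b w F P) (hQ : IsProfile h a b w F Q) {X : ℝ}
    (hX : ∀ x ∈ Icc X (X + h), Q x ≤ P x) {x : ℝ} (hx : x ≤ X) : Q x ≤ P x := by
  obtain ⟨δ, hδ, hδh, hδM⟩ := exists_step hk hF
  have hstep : ∀ k : ℕ, ∀ x ∈ Icc (X - k * δ) (X + h), Q x ≤ P x := by
    intro k
    induction k with
    | zero => simpa using hX
    | succ k ih =>
      intro x hx
      have hkδ : 0 ≤ k * δ := by positivity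
      push_cast at hx
      have := le_of_le_Icc_step hk hF hP hQ hδ hδh hδM (X := X - k * δ)
        (fun y hy => ih y ⟨hy.1, by linarith [hy.2]⟩)
      rcases le_total x (X - k * δ) with hle | hle
      · exact this x ⟨by linarith [hx.1], by linarith [hk.pos_h]⟩
      · exact ih x ⟨hle, hx.2⟩
  obtain ⟨k, hk'⟩ := exists_nat_gt ((X - x) / δ)
  rw [div_lt_iff₀ hδ] at hk'
  exact hstep k x ⟨by linarith, by linarith [hk.pos_h]⟩

lemma exists_tail_bound (hk : IsAveragingKernel h M w) (hF : IsResponse a b K κ F)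
    (hW : IsProfile h a b w F W) (t : ℝ) :
    ∃ B > 0, ∀ x, b - W x ≤ B * (b - W (t + x)) := by
  obtain ⟨δ, hδ, hδh, hδM⟩ := exists_step hk hF
  obtain ⟨k, hk'⟩ := exists_nat_gt (t / δ)
  rw [div_lt_iff₀ hδ] at hk'
  have hB : 0 < (2 * K) ^ k := pow_pos (by linarith [hF.one_le]) k
  refine ⟨(2 * K) ^ k, hB, fun x => ?_⟩
  have := sub_le_pow_mul hk hF hW.monotone hW.mem_Icc hδ hδh hδM (X := x + k * δ)
    (fun y _ => hW.eq_avg y) k le_rfl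
  refine this.trans (mul_le_mul_of_nonneg_left ?_ hB.le)
  exact sub_le_sub_left (hW.monotone (by linarith)) b

lemma lt_right (hk : IsAveragingKernel h M w) (hF : IsResponse a b K κ F)
    (hW : IsProfile h a b w F W) (x : ℝ) : W x < b := by
  refine lt_of_le_of_ne (hW.mem_Icc x).2 fun hx => ?_
  obtain ⟨z, hz⟩ := (hW.tendsto_atBot.eventually_lt_const hF.lt).exists
  obtain ⟨B, -, hB⟩ := exists_tail_bound hk hF hW (x - z)
  have := hB z
  rw [sub_add_cancel, hx, sub_self, mul_zero] at this
  linarith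

end IsProfile

/-- The relative decay of the distance to `b` over a step `τ` started at `x`. -/
noncomputable def tailRatio (b : ℝ) (W : ℝ → ℝ) (x τ : ℝ) : ℝ := (b - W (τ + x)) / (b - W x)

/-- Positive decreasing solutions of the equation linearised at `b`. -/
structure IsTailLimit (h κ : ℝ) (w U : ℝ → ℝ) : Prop where
  continuous : Continuous U
  antitone : Antitone U
  pos : ∀ x, 0 < U x
  map_zero : U 0 = 1
  eq_avg : ∀ x, U x = κ * avg h w U x

namespace IsProfile

variable {h M a b K κ : ℝ} {w F W P Q : ℝ → ℝ}

lemma tailRatio_pos (hk : IsAveragingKernel h M w) (hF : IsResponse a b K κ F)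
    (hW : IsProfile h a b w F W) (x τ : ℝ) : 0 < tailRatio b W x τ :=
  div_pos (sub_pos.2 (lt_right hk hF hW _)) (sub_pos.2 (lt_right hk hF hW _))

lemma tailRatio_antitone (hk : IsAveragingKernel h M w) (hF : IsResponse a b K κ F)
    (hW : IsProfile h a b w F W) (x : ℝ) : Antitone (tailRatio b W x) := fun s t hst =>
  div_le_div_of_nonneg_right (sub_le_sub_left (hW.monotone (by linarith)) b)
    (sub_pos.2 (lt_right hk hF hW _)).le

lemma tailRatio_zero (hk : IsAveragingKernel h M w) (hF : IsResponse a b K κ F)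
    (hW : IsProfile h a b w F W) (x : ℝ) : tailRatio b W x 0 = 1 := by
  rw [tailRatio, zero_add, div_self (sub_pos.2 (lt_right hk hF hW _)).ne']

lemma tailRatio_le_one (hk : IsAveragingKernel h M w) (hF : IsResponse a b K κ F)
    (hW : IsProfile h a b w F W) (x : ℝ) {τ : ℝ} (hτ : 0 ≤ τ) : tailRatio b W x τ ≤ 1 :=
  (tailRatio_antitone hk hF hW x hτ).trans (tailRatio_zero hk hF hW x).le

lemma tailRatio_add (hk : IsAveragingKernel h M w) (hF : IsResponse a b K κ F)
    (hW : IsProfile h a b w F W) (x s t : ℝ) :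
    tailRatio b W x (s + t) = tailRatio b W (t + x) s * tailRatio b W x t := by
  have h1 := (sub_pos.2 (lt_right hk hF hW (t + x))).ne'
  have h2 := (sub_pos.2 (lt_right hk hF hW x)).ne'
  rw [tailRatio, tailRatio, tailRatio, add_assoc]
  field_simp

lemma exists_tailRatio_le (hk : IsAveragingKernel h M w) (hF : IsResponse a b K κ F)
    (hW : IsProfile h a b w F W) (τ : ℝ) : ∃ B > 0, ∀ x, tailRatio b W x τ ≤ B := by
  obtain ⟨B, hB, hBx⟩ := exists_tail_bound hk hF hW (-τ)
  refine ⟨B, hB, fun x => ?_⟩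
  rw [tailRatio, div_le_iff₀ (sub_pos.2 (lt_right hk hF hW _))]
  simpa using hBx (τ + x)

lemma exists_le_tailRatio (hk : IsAveragingKernel h M w) (hF : IsResponse a b K κ F)
    (hW : IsProfile h a b w F W) (τ : ℝ) : ∃ B > 0, ∀ x, B ≤ tailRatio b W x τ := by
  obtain ⟨B, hB, hBx⟩ := exists_tail_bound hk hF hW τ
  refine ⟨B⁻¹, inv_pos.2 hB, fun x => ?_⟩
  rw [tailRatio, le_div_iff₀ (sub_pos.2 (lt_right hk hF hW _)), inv_mul_le_iff₀ hB]
  exact hBx x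

lemma tailRatio_eq_slope_mul (hk : IsAveragingKernel h M w) (hF : IsResponse a b K κ F)
    (hW : IsProfile h a b w F W) (x τ : ℝ) :
    tailRatio b W x τ = slope F b (avg h w W (τ + x)) * avg h w (tailRatio b W x) τ := by
  have h1 : avg h w (tailRatio b W x) τ = (b - W x)⁻¹ * (b - avg h w W (τ + x)) := by
    rw [← hk.avg_const_sub hW.monotone b (τ + x), ← avg_comp_add h w (fun y => b - W y) x τ,
      ← avg_const_mul]
    congr 1
    ext y
    rw [tailRatio, div_eq_inv_mul]
  have h2 : avg h w W (τ + x) < b :=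
    (hk.avg_le_apply_add hW.monotone _).trans_lt (lt_right hk hF hW _)
  have h3 := (sub_neg.2 h2).ne
  have h4 := (sub_pos.2 (lt_right hk hF hW x)).ne'
  rw [h1, slope_def_field, hF.map_right, ← hW.eq_avg, tailRatio]
  field_simp
  ring

/-- Blow-up limits at `+∞`. -/
lemma exists_tailLimit (hk : IsAveragingKernel h M w) (hF : IsResponse a b K κ F)
    (hW : IsProfile h a b w F W) {xs : ℕ → ℝ} (hxs : Tendsto xs atTop atTop) :
    ∃ φ : ℕ → ℕ, StrictMono φ ∧ ∃ U, IsTailLimit h κ w U ∧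
      ∀ x, Tendsto (fun n => tailRatio b W (xs (φ n)) x) atTop (𝓝 (U x)) := by
  have hKM := mul_nonneg (zero_le_one.trans hF.one_le) hk.bound_pos.le
  have hpos := tailRatio_pos hk hF hW
  obtain ⟨φ, hφ, U, hUc, hU⟩ := exists_subseq_tendsto_of_locally_lipschitz
    (q := fun n => tailRatio b W (xs n))
    (fun x => by
      obtain ⟨B, -, hB⟩ := exists_tailRatio_le hk hF hW x
      exact ⟨B, fun n => by rw [abs_of_pos (hpos _ _)]; exact hB _⟩)
    (fun x => by
      obtain ⟨B, hB0, hB⟩ := exists_tailRatio_le hk hF hW (x - 1)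
      refine ⟨K * M * B, 1, one_pos, Eventually.of_forall fun n y hy => ?_⟩
      rw [abs_lt] at hy
      have hd := sub_pos.2 (lt_right hk hF hW (xs n))
      have h1 := abs_sub_le_of_eq hk hF hW.monotone hW.mem_Icc (x := x + xs n) (y := y + xs n)
        (z := x - 1 + xs n) (by linarith) (by linarith [hy.1]) (hW.eq_avg _) (hW.eq_avg _)
      have h2 := hB (xs n)
      rw [tailRatio, div_le_iff₀ hd] at h2
      rw [tailRatio, tailRatio, ← sub_div, abs_div, abs_of_pos hd, div_le_iff₀ hd,
        sub_sub_sub_cancel_left, abs_sub_comm]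
      rw [add_sub_add_right_eq_sub] at h1
      calc _ ≤ _ := h1
        _ ≤ K * M * |y - x| * (B * (b - W (xs n))) := by gcongr
        _ = _ := by ring)
  have hanti : Antitone U := fun x y hxy => le_of_tendsto_of_tendsto' (hU y) (hU x) fun n =>
    tailRatio_antitone hk hF hW _ hxy
  refine ⟨φ, hφ, U, ⟨hUc, hanti, fun x => ?_, ?_, fun x => ?_⟩, hU⟩
  · obtain ⟨B, hB0, hB⟩ := exists_le_tailRatio hk hF hW x
    exact hB0.trans_le (ge_of_tendsto' (hU x) fun n => hB _)
  · exact tendsto_nhds_unique (hU 0) (by simp [tailRatio_zero hk hF hW])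
  · have hxφ : Tendsto (fun n => x + xs (φ n)) atTop atTop :=
      tendsto_atTop_add_const_left _ x (hxs.comp hφ.tendsto_atTop)
    have hA : Tendsto (fun n => avg h w W (x + xs (φ n))) atTop (𝓝[≠] b) := by
      refine tendsto_nhdsWithin_iff.2 ⟨?_, Eventually.of_forall fun n => ?_⟩
      · exact tendsto_of_tendsto_of_tendsto_of_le_of_le (hW.tendsto_atTop.comp hxφ)
          tendsto_const_nhds (fun n => hk.apply_le_avg hW.monotone _)
          (fun n => (hk.avg_mem_Icc hW.monotone hW.mem_Icc _).2)
      · exact ((hk.avg_le_apply_add hW.monotone _).trans_lt (lt_right hk hF hW _)).ne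
    have hslope := hF.hasDerivAt.tendsto_slope.comp hA
    obtain ⟨B, -, hB⟩ := exists_tailRatio_le hk hF hW x
    have havg := hk.tendsto_avg (q := fun n => tailRatio b W (xs (φ n))) (x := x) (C := B)
      (fun n => (tailRatio_antitone hk hF hW _).measurable)
      (fun n s hs => by
        rw [abs_of_pos (hpos _ _)]
        exact (tailRatio_antitone hk hF hW _ (by linarith [hs.1])).trans (hB _)) hU
    refine tendsto_nhds_unique (hU x) ((hslope.mul havg).congr fun n => ?_)
    exact (tailRatio_eq_slope_mul hk hF hW _ _).symm

end IsProfile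

section Linear

variable {h M κ τ : ℝ} {w D U V : ℝ → ℝ}

/-- A nonnegative solution of the linear equation that vanishes at a point vanishes to its
right. -/
lemma IsAveragingKernel.eq_zero_of_touching (hk : IsAveragingKernel h M w) (hκ : κ ≠ 0)
    (hD : Continuous D) {x₀ : ℝ} (h0 : ∀ x, x₀ ≤ x → 0 ≤ D x)
    (heq : ∀ x, D x = κ * avg h w D x) (hx₀ : D x₀ = 0) {x : ℝ} (hx : x₀ ≤ x) : D x = 0 := by
  have hstep : ∀ k : ℕ, ∀ y ∈ Icc x₀ (x₀ + k * h), D y = 0 := by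
    intro k
    induction k with
    | zero =>
      intro y hy
      rw [show y = x₀ from le_antisymm (by simpa using hy.2) hy.1, hx₀]
    | succ k ih =>
      intro y hy
      push_cast at hy
      have hkh : 0 ≤ k * h := mul_nonneg k.cast_nonneg hk.pos_h.le
      rcases le_total y (x₀ + k * h) with hle | hle
      · exact ih y ⟨hy.1, hle⟩
      · have hz := ih (x₀ + k * h) ⟨by linarith, le_rfl⟩
        rw [heq] at hz
        have := hk.eq_zero_of_avg_eq_zero hD (x := x₀ + k * h)
          (fun s hs => h0 _ (by linarith [hs.1])) ((mul_eq_zero.1 hz).resolve_left hκ)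
          (y - (x₀ + k * h)) ⟨by linarith, by linarith [hy.2]⟩
        simpa using this
  obtain ⟨k, hk'⟩ := exists_nat_gt ((x - x₀) / h)
  rw [div_lt_iff₀ hk.pos_h] at hk'
  exact hstep k x ⟨hx, by linarith⟩

lemma IsTailLimit.decay_le (hk : IsAveragingKernel h M w) (hκ : κ ≠ 0)
    (hU : IsTailLimit h κ w U) (hV : IsTailLimit h κ w V) (hτ : 0 < τ) {p q : ℝ}
    (hUp : ∀ x, 0 ≤ x → U (τ + x) = p * U x) (hVq : ∀ x, 0 ≤ x → V (τ + x) = q * V x) :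
    p ≤ q := by
  by_contra! hqp
  have hq : 0 < q := by
    have := hVq 0 le_rfl
    rw [hV.map_zero, mul_one] at this
    exact this ▸ hV.pos _
  obtain ⟨x₀, hx₀, hmin⟩ := isCompact_Icc.exists_isMinOn (nonempty_Icc.2 hτ.le)
    (hU.continuous.div hV.continuous fun x => (hV.pos x).ne').continuousOn
  set θ := U x₀ / V x₀ with hθ
  have hθ0 : 0 < θ := div_pos (hU.pos _) (hV.pos _)
  have hstep : ∀ k : ℕ, ∀ x ∈ Icc 0 (τ + k * τ), θ * V x ≤ U x := by
    intro k
    induction k with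
    | zero =>
      intro x hx
      rw [← le_div_iff₀ (hV.pos x)]
      exact hmin (by simpa using hx)
    | succ k ih =>
      intro x hx
      push_cast at hx
      have hkτ : 0 ≤ k * τ := mul_nonneg k.cast_nonneg hτ.le
      rcases le_total x τ with hle | hle
      · exact ih x ⟨hx.1, by linarith⟩
      · have h1 := ih (x - τ) ⟨by linarith, by linarith [hx.2]⟩
        have h2 := hUp (x - τ) (by linarith)
        have h3 := hVq (x - τ) (by linarith)
        rw [add_sub_cancel] at h2 h3
        rw [h2, h3]
        calc θ * (q * V (x - τ)) = q * (θ * V (x - τ)) := by ring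
          _ ≤ q * U (x - τ) := mul_le_mul_of_nonneg_left h1 hq.le
          _ ≤ p * U (x - τ) := mul_le_mul_of_nonneg_right hqp.le (hU.pos _).le
  have hle : ∀ x, 0 ≤ x → θ * V x ≤ U x := by
    intro x hx
    obtain ⟨k, hk'⟩ := exists_nat_gt (x / τ)
    rw [div_lt_iff₀ hτ] at hk'
    exact hstep k x ⟨hx, by linarith⟩
  have hiU := hk.avgIntegrable_of_continuous hU.continuous
  have hiV := hk.avgIntegrable_of_continuous hV.continuous
  have hzero : U (τ + x₀) - θ * V (τ + x₀) = 0 :=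
    hk.eq_zero_of_touching hκ (D := fun x => U x - θ * V x)
      (hU.continuous.sub (hV.continuous.const_mul θ)) (x₀ := x₀)
      (fun x hx => sub_nonneg.2 (hle x (hx₀.1.trans hx)))
      (fun x => by
        rw [hiU.avg_sub (hiV.const_mul θ), avg_const_mul, mul_sub, ← hU.eq_avg,
          mul_left_comm, ← hV.eq_avg])
      (by rw [hθ, div_mul_cancel₀ _ (hV.pos _).ne', sub_self]) (by linarith)
  have hUx₀ : U x₀ = θ * V x₀ := by rw [hθ, div_mul_cancel₀ _ (hV.pos _).ne']
  rw [hUp x₀ hx₀.1, hVq x₀ hx₀.1, hUx₀] at hzero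
  have : 0 < (p - q) * (θ * V x₀) := mul_pos (sub_pos.2 hqp) (mul_pos hθ0 (hV.pos _))
  nlinarith

end Linear

namespace IsProfile

variable {h M a b K κ τ : ℝ} {w F W W₁ W₂ : ℝ → ℝ}

lemma exists_tailLimit_of_extremal (hk : IsAveragingKernel h M w) (hF : IsResponse a b K κ F)
    (hW : IsProfile h a b w F W) {σ p : ℝ} (hσ : σ ≠ 0) {xs : ℕ → ℝ}
    (hxs : Tendsto xs atTop atTop)
    (hlim : Tendsto (fun n => tailRatio b W (xs n) τ) atTop (𝓝 p))
    (hext : ∀ ε > 0, ∀ᶠ x in atTop, σ * tailRatio b W x τ ≤ σ * p + ε) :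
    ∃ U, IsTailLimit h κ w U ∧ ∀ x, 0 ≤ x → U (τ + x) = p * U x := by
  obtain ⟨φ, hφ, U, hU, hUlim⟩ := exists_tailLimit hk hF hW hxs
  have hle : ∀ x, σ * U (τ + x) ≤ σ * p * U x := by
    intro x
    have hε : ∀ ε > 0, σ * U (τ + x) ≤ (σ * p + ε) * U x := by
      intro ε hε
      refine le_of_tendsto_of_tendsto ((hUlim (τ + x)).const_mul σ)
        ((hUlim x).const_mul (σ * p + ε)) ?_
      have hx : Tendsto (fun n => x + xs (φ n)) atTop atTop :=
        tendsto_atTop_add_const_left _ _ (hxs.comp hφ.tendsto_atTop)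
      filter_upwards [hx.eventually (hext ε hε)] with n hn
      rw [tailRatio_add hk hF hW, ← mul_assoc]
      exact mul_le_mul_of_nonneg_right hn (tailRatio_pos hk hF hW _ _).le
    refine le_of_forall_pos_le_add fun δ hδ => (hε (δ / U x) (div_pos hδ (hU.pos x))).trans_eq ?_
    rw [add_mul, div_mul_cancel₀ _ (hU.pos x).ne']
  have hp : U τ = p := tendsto_nhds_unique (hUlim τ) (hlim.comp hφ.tendsto_atTop)
  refine ⟨U, hU, fun x hx => ?_⟩
  have hi := hk.avgIntegrable_of_continuous hU.continuous
  have hzero : σ * p * U x - σ * U (x + τ) = 0 :=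
    hk.eq_zero_of_touching (zero_lt_one.trans hF.one_lt).ne'
      (D := fun x => σ * p * U x - σ * U (x + τ))
      ((hU.continuous.const_mul _).sub
        ((hU.continuous.comp (continuous_add_const τ)).const_mul σ))
      (fun y _ => by rw [add_comm y]; exact sub_nonneg.2 (hle y))
      (fun y => by
        rw [(hi.const_mul _).avg_sub ((hi.comp_add τ).const_mul σ),
          avg_const_mul h w (fun x => U (x + τ)), avg_const_mul, avg_comp_add, mul_sub,
          mul_left_comm, ← hU.eq_avg, mul_left_comm, ← hU.eq_avg])
      (by rw [zero_add, hU.map_zero, hp, mul_one, sub_self]) hx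
  rw [add_comm τ]
  exact mul_left_cancel₀ hσ (by linarith)

lemma exists_tendsto_tailRatio (hk : IsAveragingKernel h M w) (hF : IsResponse a b K κ F)
    (hW₁ : IsProfile h a b w F W₁) (hW₂ : IsProfile h a b w F W₂) (hτ : 0 < τ) :
    ∃ p, Tendsto (fun x => tailRatio b W₁ x τ) atTop (𝓝 p) ∧
      Tendsto (fun x => tailRatio b W₂ x τ) atTop (𝓝 p) := by
  have hκ : κ ≠ 0 := (zero_lt_one.trans hF.one_lt).ne'
  have hbdd : ∀ {W}, IsProfile h a b w F W →
      IsBoundedUnder (· ≤ ·) atTop (fun x => tailRatio b W x τ) ∧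
      IsBoundedUnder (· ≥ ·) atTop (fun x => tailRatio b W x τ) := fun hW =>
    ⟨isBoundedUnder_of ⟨1, fun x => tailRatio_le_one hk hF hW x hτ.le⟩,
      isBoundedUnder_of ⟨0, fun x => (tailRatio_pos hk hF hW x τ).le⟩⟩
  have hsup : ∀ {W}, IsProfile h a b w F W → ∃ U, IsTailLimit h κ w U ∧
      ∀ x, 0 ≤ x → U (τ + x) = limsup (fun x => tailRatio b W x τ) atTop * U x := by
    intro W hW
    obtain ⟨hle, hge⟩ := hbdd hW
    obtain ⟨xs, hlim, hxs⟩ := exists_seq_tendsto_limsup hge.isCoboundedUnder_flip hle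
    refine exists_tailLimit_of_extremal hk hF hW (σ := 1) one_ne_zero hxs hlim fun ε hε => ?_
    filter_upwards [eventually_lt_of_limsup_lt (lt_add_of_pos_right _ hε) hle] with x hx
    linarith
  have hinf : ∀ {W}, IsProfile h a b w F W → ∃ U, IsTailLimit h κ w U ∧
      ∀ x, 0 ≤ x → U (τ + x) = liminf (fun x => tailRatio b W x τ) atTop * U x := by
    intro W hW
    obtain ⟨hle, hge⟩ := hbdd hW
    obtain ⟨xs, hlim, hxs⟩ := exists_seq_tendsto_liminf hle.isCoboundedUnder_flip hge
    refine exists_tailLimit_of_extremal hk hF hW (σ := -1) (by norm_num) hxs hlim fun ε hε => ?_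
    filter_upwards [eventually_lt_of_lt_liminf (sub_lt_self _ hε) hge] with x hx
    linarith
  have hle : ∀ {W W'}, IsProfile h a b w F W → IsProfile h a b w F W' →
      limsup (fun x => tailRatio b W x τ) atTop ≤ liminf (fun x => tailRatio b W' x τ) atTop := by
    intro W W' hW hW'
    obtain ⟨U, hU, hUp⟩ := hsup hW
    obtain ⟨V, hV, hVq⟩ := hinf hW'
    exact hU.decay_le hk hκ hV hτ hUp hVq
  exact ⟨_, tendsto_of_le_liminf_of_limsup_le le_rfl (hle hW₁ hW₁) (hbdd hW₁).1 (hbdd hW₁).2,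
    tendsto_of_le_liminf_of_limsup_le
      ((liminf_le_limsup (hbdd hW₁).1 (hbdd hW₁).2).trans (hle hW₁ hW₂))
      (hle hW₂ hW₁) (hbdd hW₂).1 (hbdd hW₂).2⟩

/-- All profiles have the same strictly decreasing asymptotic tail. -/
lemma exists_common_tail (hk : IsAveragingKernel h M w) (hF : IsResponse a b K κ F)
    (hW₁ : IsProfile h a b w F W₁) (hW₂ : IsProfile h a b w F W₂) :
    ∃ V : ℝ → ℝ, (∀ s t, 0 ≤ s → s < t → V t < V s) ∧ ∀ s, 0 ≤ s →
      Tendsto (fun x => tailRatio b W₁ x s) atTop (𝓝 (V s)) ∧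
      Tendsto (fun x => tailRatio b W₂ x s) atTop (𝓝 (V s)) := by
  obtain ⟨φ, hφ, V, hV, hVlim⟩ := exists_tailLimit hk hF hW₁ tendsto_natCast_atTop_atTop
  have hlim : ∀ s, 0 ≤ s → Tendsto (fun x => tailRatio b W₁ x s) atTop (𝓝 (V s)) ∧
      Tendsto (fun x => tailRatio b W₂ x s) atTop (𝓝 (V s)) := by
    intro s hs
    rcases hs.eq_or_lt with rfl | hs
    · simp only [tailRatio_zero hk hF hW₁, tailRatio_zero hk hF hW₂, hV.map_zero,
        tendsto_const_nhds, and_self]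
    · obtain ⟨p, h1, h2⟩ := exists_tendsto_tailRatio hk hF hW₁ hW₂ hs
      rw [tendsto_nhds_unique (hVlim s)
        (h1.comp (tendsto_natCast_atTop_atTop.comp hφ.tendsto_atTop))]
      exact ⟨h1, h2⟩
  have hadd : ∀ s t, 0 ≤ s → 0 ≤ t → V (s + t) = V s * V t := by
    intro s t hs ht
    refine tendsto_nhds_unique (hlim _ (add_nonneg hs ht)).1 ((((hlim s hs).1.comp
      (tendsto_atTop_add_const_left atTop t tendsto_id)).mul (hlim t ht).1).congr fun x => ?_)
    exact (tailRatio_add hk hF hW₁ x s t).symm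
  have hlt : ∀ t, 0 < t → V t < 1 := by
    intro t ht
    refine lt_of_le_of_ne ((hV.antitone ht.le).trans_eq hV.map_zero) fun h1 => ?_
    have hpow : ∀ k : ℕ, V (k * t) = 1 := by
      intro k
      induction k with
      | zero => simpa using hV.map_zero
      | succ k ih =>
        rw [Nat.cast_succ, add_one_mul, hadd _ _ (by positivity) ht.le, ih, h1, one_mul]
    obtain ⟨k, hk'⟩ := exists_nat_gt (h / t)
    rw [div_lt_iff₀ ht] at hk'
    have havg : 1 ≤ avg h w V 0 :=
      hk.const_le_avg (hk.avgIntegrable_of_continuous hV.continuous) fun s hs =>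
        (hpow k).symm.trans_le (hV.antitone (by linarith [hs.2]))
    have := hV.eq_avg 0
    rw [hV.map_zero] at this
    nlinarith [hF.one_lt]
  refine ⟨V, fun s t hs hst => ?_, hlim⟩
  rw [← add_sub_cancel s t, hadd s (t - s) hs (sub_nonneg.2 hst.le)]
  exact mul_lt_of_lt_one_right (hV.pos s) (hlt _ (sub_pos.2 hst))

end IsProfile

namespace IsProfile

variable {h M a b K κ : ℝ} {w F W W₁ W₂ : ℝ → ℝ}

lemma eventually_le_shift (hk : IsAveragingKernel h M w) (hF : IsResponse a b K κ F)
    (hW₁ : IsProfile h a b w F W₁) (hW₂ : IsProfile h a b w F W₂) {xs ys : ℕ → ℝ}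
    (hxs : Tendsto xs atTop atTop) (hys : Tendsto ys atTop atTop)
    (heq : ∀ n, W₁ (xs n) = W₂ (ys n)) {ε : ℝ} (hε : 0 < ε) :
    ∀ᶠ n in atTop, ∀ z ≤ xs n, W₁ z ≤ W₂ (z + (ys n - xs n + ε)) := by
  obtain ⟨V, hV, hlim⟩ := exists_common_tail hk hF hW₁ hW₂
  have hη := half_pos hε
  set N := ⌊h / (ε / 2)⌋₊
  have hgrid : ∀ᶠ n in atTop, ∀ j ∈ Finset.range (N + 1),
      tailRatio b W₂ (ys n) (j * (ε / 2) + ε) < tailRatio b W₁ (xs n) ((j + 1) * (ε / 2)) := by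
    rw [eventually_all_finset]
    intro j _
    have hj : (0 : ℝ) ≤ j * (ε / 2) := by positivity
    exact ((hlim _ (by linarith)).2.comp hys).eventually_lt ((hlim _ (by linarith)).1.comp hxs)
      (hV _ _ (by linarith) (by linarith))
  filter_upwards [hgrid] with n hn z hz
  refine le_of_le_Icc hk hF (hW₂.comp_add (ys n - xs n + ε)) hW₁ (fun x hx => ?_) hz
  have hs : 0 ≤ (x - xs n) / (ε / 2) := div_nonneg (sub_nonneg.2 hx.1) hη.le
  have h1 := Nat.floor_le hs
  have h2 := Nat.lt_floor_add_one ((x - xs n) / (ε / 2))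
  have hj : ⌊(x - xs n) / (ε / 2)⌋₊ ≤ N :=
    Nat.floor_le_floor (div_le_div_of_nonneg_right (by linarith [hx.2]) hη.le)
  set j := ⌊(x - xs n) / (ε / 2)⌋₊
  rw [le_div_iff₀ hη] at h1
  rw [div_lt_iff₀ hη] at h2
  have h3 := hn j (Finset.mem_range.2 (Nat.lt_succ_of_le hj))
  rw [tailRatio, tailRatio, heq,
    div_lt_div_iff_of_pos_right (sub_pos.2 (lt_right hk hF hW₂ _))] at h3
  have h4 := hW₁.monotone (show x ≤ (j + 1) * (ε / 2) + xs n by linarith)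
  have h5 := hW₂.monotone
    (show j * (ε / 2) + ε + ys n ≤ x + (ys n - xs n + ε) by linarith)
  linarith

lemma exists_eq (hW : IsProfile h a b w F W) {y : ℝ} (hy : y ∈ Ioo a b) : ∃ x, W x = y := by
  obtain ⟨p, hp⟩ := (hW.tendsto_atBot.eventually_le_const hy.1).exists
  obtain ⟨q, hq⟩ := (hW.tendsto_atTop.eventually_const_le hy.2).exists
  exact mem_range_of_exists_le_of_exists_ge hW.continuous ⟨p, hp⟩ ⟨q, hq⟩

lemma tendsto_atTop_of_tendsto (hk : IsAveragingKernel h M w) (hF : IsResponse a b K κ F)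
    (hW : IsProfile h a b w F W) {xs : ℕ → ℝ}
    (hlim : Tendsto (fun n => W (xs n)) atTop (𝓝 b)) : Tendsto xs atTop atTop := by
  refine Filter.tendsto_atTop.2 fun B => ?_
  filter_upwards [hlim.eventually_const_lt (lt_right hk hF hW B)] with n hn
  exact (hW.monotone.reflect_lt hn).le

/-- The offsets between points at which two profiles coincide are bounded above. -/
lemma exists_eventually_sub_le (hk : IsAveragingKernel h M w) (hF : IsResponse a b K κ F)
    (hW₁ : IsProfile h a b w F W₁) (hW₂ : IsProfile h a b w F W₂) {xs ys : ℕ → ℝ}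
    (hxs : Tendsto xs atTop atTop) (hys : Tendsto ys atTop atTop)
    (heq : ∀ n, W₁ (xs n) = W₂ (ys n)) : ∃ B, ∀ᶠ n in atTop, xs n - ys n ≤ B := by
  obtain ⟨z, hz⟩ := hW₁.exists_eq (y := (a + b) / 2)
    ⟨by linarith [hF.lt], by linarith [hF.lt]⟩
  obtain ⟨z', hz'⟩ := (hW₂.tendsto_atBot.eventually_lt_const
    (show a < (a + b) / 2 by linarith [hF.lt])).exists
  refine ⟨z + 1 - z', ?_⟩
  filter_upwards [eventually_le_shift hk hF hW₁ hW₂ hxs hys heq one_pos,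
    hxs.eventually_ge_atTop z] with n hn hxn
  have := hW₂.monotone.reflect_lt ((hz'.trans_eq hz.symm).trans_le (hn z hxn))
  linarith

lemma le_shift_of_tendsto (hk : IsAveragingKernel h M w) (hF : IsResponse a b K κ F)
    (hW₁ : IsProfile h a b w F W₁) (hW₂ : IsProfile h a b w F W₂) {xs ys : ℕ → ℝ}
    (hxs : Tendsto xs atTop atTop) (hys : Tendsto ys atTop atTop)
    (heq : ∀ n, W₁ (xs n) = W₂ (ys n)) {c : ℝ}
    (hc : Tendsto (fun n => ys n - xs n) atTop (𝓝 c)) (z : ℝ) : W₁ z ≤ W₂ (z + c) := by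
  have hε : ∀ ε > 0, W₁ z ≤ W₂ (z + (c + ε)) := by
    intro ε hε
    refine ge_of_tendsto ((hW₂.continuous.tendsto _).comp
      ((hc.add_const ε).const_add z)) ?_
    filter_upwards [eventually_le_shift hk hF hW₁ hW₂ hxs hys heq hε,
      hxs.eventually_ge_atTop z] with n hn hxn
    exact hn z hxn
  have hlim : Tendsto (fun ε => W₂ (z + (c + ε))) (𝓝[>] 0) (𝓝 (W₂ (z + c))) := by
    have : Continuous fun ε => W₂ (z + (c + ε)) := hW₂.continuous.comp (by fun_prop)
    simpa using (this.tendsto 0).mono_left nhdsWithin_le_nhds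
  refine ge_of_tendsto hlim ?_
  filter_upwards [self_mem_nhdsWithin] with ε h using hε ε h

theorem exists_eq_shift (hk : IsAveragingKernel h M w) (hF : IsResponse a b K κ F)
    (hW₁ : IsProfile h a b w F W₁) (hW₂ : IsProfile h a b w F W₂) :
    ∃ c, ∀ x, W₂ x = W₁ (x + c) := by
  have hba := sub_pos.2 hF.lt
  have hinv : Tendsto (fun n : ℕ => b - (b - a) / (n + 2)) atTop (𝓝 b) := by
    have : Tendsto (fun n : ℕ => (n : ℝ) + 2) atTop atTop :=
      tendsto_atTop_add_const_right _ _ tendsto_natCast_atTop_atTop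
    simpa using (this.const_div_atTop (b - a)).const_sub b
  have hmem : ∀ n : ℕ, b - (b - a) / (n + 2) ∈ Ioo a b := by
    intro n
    have h1 : (b - a) / (n + 2) < b - a :=
      div_lt_self hba (by linarith [(Nat.cast_nonneg n : (0 : ℝ) ≤ n)])
    have h2 : 0 < (b - a) / (n + 2) := by positivity
    exact ⟨by linarith, by linarith⟩
  choose xs hxs using fun n => hW₁.exists_eq (hmem n)
  choose ys hys using fun n => hW₂.exists_eq (hmem n)
  have heq : ∀ n, W₁ (xs n) = W₂ (ys n) := fun n => (hxs n).trans (hys n).symm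
  have hxt := tendsto_atTop_of_tendsto hk hF hW₁ (xs := xs) (by simpa only [hxs] using hinv)
  have hyt := tendsto_atTop_of_tendsto hk hF hW₂ (xs := ys) (by simpa only [hys] using hinv)
  obtain ⟨B, hB⟩ := exists_eventually_sub_le hk hF hW₁ hW₂ hxt hyt heq
  obtain ⟨C, hC⟩ := exists_eventually_sub_le hk hF hW₂ hW₁ hyt hxt fun n => (heq n).symm
  obtain ⟨c, -, φ, hφ, hc⟩ := (isCompact_Icc (a := -C) (b := B)).tendsto_subseq'
    (x := fun n => xs n - ys n) (by
      refine Eventually.frequently ?_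
      filter_upwards [hB, hC] with n h1 h2
      exact ⟨by linarith, h1⟩)
  have hxφ := hxt.comp hφ.tendsto_atTop
  have hyφ := hyt.comp hφ.tendsto_atTop
  refine ⟨c, fun x => le_antisymm ?_ ?_⟩
  · exact le_shift_of_tendsto hk hF hW₂ hW₁ hyφ hxφ (fun n => (heq _).symm) hc x
  · have := le_shift_of_tendsto hk hF hW₁ hW₂ hxφ hyφ (fun n => heq _)
      (c := -c) (hc.neg.congr fun n => by simp) (x + c)
    rwa [add_neg_cancel_right] at this

end IsProfile

section Velocity

variable {v : ℝ → ℝ}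

lemma strictAntiOn_of_deriv_neg_Icc (hv' : ∀ ρ ∈ Icc (0 : ℝ) 1, deriv v ρ < 0) :
    StrictAntiOn v (Icc 0 1) :=
  strictAntiOn_of_deriv_neg (convex_Icc 0 1)
    (fun ρ hρ => (differentiableAt_of_deriv_ne_zero (hv' ρ hρ).ne).continuousAt.continuousWithinAt)
    fun ρ hρ => hv' ρ (interior_subset hρ)

lemma antitoneOn_deriv (hv : ContDiffOn ℝ 2 v (Icc 0 1))
    (hv'' : ∀ ρ ∈ Icc (0 : ℝ) 1, deriv (deriv v) ρ ≤ 0) : AntitoneOn (deriv v) (Ioo 0 1) := by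
  have hd : ContDiffOn ℝ 1 (deriv v) (Ioo 0 1) :=
    (hv.mono Ioo_subset_Icc_self).deriv_of_isOpen isOpen_Ioo (by norm_num)
  refine antitoneOn_of_deriv_nonpos (convex_Ioo 0 1) hd.continuousOn ?_ ?_ <;>
    rw [interior_Ioo]
  · exact hd.differentiableOn one_ne_zero
  · exact fun ρ hρ => hv'' ρ (Ioo_subset_Icc_self hρ)

lemma deriv_flux (hv' : ∀ ρ ∈ Icc (0 : ℝ) 1, deriv v ρ < 0) {ρ : ℝ} (hρ : ρ ∈ Icc (0 : ℝ) 1) :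
    deriv (fun ρ => ρ * v ρ) ρ = v ρ + ρ * deriv v ρ := by
  have := (hasDerivAt_id ρ).mul (differentiableAt_of_deriv_ne_zero (hv' ρ hρ).ne).hasDerivAt
  rw [one_mul] at this
  exact this.deriv

lemma strictAntiOn_deriv_flux (hv : ContDiffOn ℝ 2 v (Icc 0 1))
    (hv' : ∀ ρ ∈ Icc (0 : ℝ) 1, deriv v ρ < 0)
    (hv'' : ∀ ρ ∈ Icc (0 : ℝ) 1, deriv (deriv v) ρ ≤ 0) :
    StrictAntiOn (deriv fun ρ => ρ * v ρ) (Ioo 0 1) := by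
  intro x hx y hy hxy
  have hx' := Ioo_subset_Icc_self hx
  have hy' := Ioo_subset_Icc_self hy
  rw [deriv_flux hv' hx', deriv_flux hv' hy']
  have h1 := strictAntiOn_of_deriv_neg_Icc hv' hx' hy' hxy
  have h2 := mul_le_mul_of_nonneg_left (antitoneOn_deriv hv hv'' hx hy hxy.le) hx.1.le
  have h3 := mul_le_mul_of_nonpos_right hxy.le (hv' y hy').le
  linarith

lemma exists_isResponse (hv : ContDiffOn ℝ 2 v (Icc 0 1)) (hv1 : v 1 = 0)
    (hv' : ∀ ρ ∈ Icc (0 : ℝ) 1, deriv v ρ < 0)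
    (hv'' : ∀ ρ ∈ Icc (0 : ℝ) 1, deriv (deriv v) ρ ≤ 0) {c a b q : ℝ}
    (hcrit : deriv (fun ρ => ρ * v ρ) c = 0) (ha : 0 < a) (hb : b < 1) (hac : a < c)
    (hcb : c < b) (hqa : q = a * v a) (hqb : q = b * v b) :
    ∃ K κ, IsResponse a b K κ (fun x => q / v x) := by
  have hanti := strictAntiOn_of_deriv_neg_Icc hv'
  have hsub : Icc a b ⊆ Ioo 0 1 := Icc_subset_Ioo ha hb
  have hsub' : Icc a b ⊆ Icc 0 1 := hsub.trans Ioo_subset_Icc_self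
  have hbm : b ∈ Icc a b := right_mem_Icc.2 (hac.trans hcb).le
  have ham : a ∈ Icc a b := left_mem_Icc.2 (hac.trans hcb).le
  have hcm : c ∈ Icc a b := ⟨hac.le, hcb.le⟩
  have hpos : ∀ x ∈ Icc a b, 0 < v x := fun x hx =>
    hv1.symm.trans_lt (hanti (hsub' hx) (right_mem_Icc.2 zero_le_one) (hsub hx).2)
  have hq : 0 < q := hqa ▸ mul_pos ha (hpos a ham)
  have hdiff : ∀ x ∈ Icc a b, DifferentiableAt ℝ v x := fun x hx =>
    differentiableAt_of_deriv_ne_zero (hv' x (hsub' hx)).ne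
  have hcont : ContinuousOn (fun ρ => ρ * v ρ) (Icc a b) := fun x hx =>
    (continuousAt_id.mul (hdiff x hx).continuousAt).continuousWithinAt
  have hflux' := strictAntiOn_deriv_flux hv hv' hv''
  have hinc : StrictMonoOn (fun ρ => ρ * v ρ) (Icc a c) := by
    refine strictMonoOn_of_deriv_pos (convex_Icc a c)
      (hcont.mono (Icc_subset_Icc_right hcb.le)) fun x hx => ?_
    rw [interior_Icc] at hx
    exact hcrit.symm.trans_lt
      (hflux' (hsub ⟨hx.1.le, (hx.2.trans hcb).le⟩) (hsub hcm) hx.2)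
  have hdec : StrictAntiOn (fun ρ => ρ * v ρ) (Icc c b) := by
    refine strictAntiOn_of_deriv_neg (convex_Icc c b)
      (hcont.mono (Icc_subset_Icc_left hac.le)) fun x hx => ?_
    rw [interior_Icc] at hx
    exact (hflux' (hsub hcm) (hsub ⟨(hac.trans hx.1).le, hx.2.le⟩) hx.1).trans_eq hcrit
  have hlip : ∀ x ∈ Icc a b, ∀ y ∈ Icc a b, x ≤ y → deriv v b * (y - x) ≤ v y - v x := by
    refine (convex_Icc a b).mul_sub_le_image_sub_of_le_deriv
      (fun x hx => (hdiff x hx).continuousAt.continuousWithinAt)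
      (fun x hx => (hdiff x (interior_subset hx)).differentiableWithinAt) fun x hx => ?_
    exact antitoneOn_deriv hv hv'' (hsub (interior_subset hx)) (hsub hbm) (interior_subset hx).2
  have hvb := hpos b hbm
  have hv'b := hv' b (hsub' hbm)
  have hκ : 0 ≤ q * -deriv v b / v b ^ 2 := by
    have := neg_pos.2 hv'b
    positivity
  refine ⟨1 + q * -deriv v b / v b ^ 2, q * -deriv v b / v b ^ 2, ?_⟩
  exact {
    lt := hac.trans hcb
    strictMonoOn := fun x hx y hy hxy =>
      div_lt_div_of_pos_left hq (hpos y hy) (hanti (hsub' hx) (hsub' hy) hxy)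
    one_le := by linarith
    sub_le := by
      intro x hx y hy hxy
      have hvx := hpos x hx
      have hvy := hpos y hy
      have hle : v b ^ 2 ≤ v x * v y := by
        rw [sq]
        exact mul_le_mul (hanti.antitoneOn (hsub' hx) (hsub' hbm) hx.2)
          (hanti.antitoneOn (hsub' hy) (hsub' hbm) hy.2) hvb.le hvx.le
      have h1 : 0 ≤ -deriv v b * (y - x) :=
        mul_nonneg (neg_pos.2 hv'b).le (sub_nonneg.2 hxy)
      calc q / v y - q / v x = q * (v x - v y) / (v x * v y) := by field_simp
        _ ≤ q * (-deriv v b * (y - x)) / (v x * v y) := by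
          gcongr
          linarith [hlip x hx y hy hxy]
        _ ≤ q * (-deriv v b * (y - x)) / v b ^ 2 := by gcongr
        _ = q * -deriv v b / v b ^ 2 * (y - x) := by ring
        _ ≤ (1 + q * -deriv v b / v b ^ 2) * (y - x) :=
          mul_le_mul_of_nonneg_right (by linarith) (sub_nonneg.2 hxy)
    map_left := by rw [hqa, mul_div_cancel_right₀ _ (hpos a ham).ne']
    map_right := by rw [hqb, mul_div_cancel_right₀ _ hvb.ne']
    lt_self := by
      intro x hx
      rw [div_lt_iff₀ (hpos x ⟨hx.1.le, hx.2.le⟩)]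
      rcases le_total x c with hxc | hxc
      · exact hqa.trans_lt (hinc (left_mem_Icc.2 hac.le) ⟨hx.1.le, hxc⟩ hx.1)
      · exact hqb.trans_lt (hdec ⟨hxc, hx.2.le⟩ (right_mem_Icc.2 hcb.le) hx.2)
    hasDerivAt := by
      refine ((hasDerivAt_const b q).div (hdiff b hbm).hasDerivAt hvb.ne').congr_deriv ?_
      rw [zero_mul, zero_sub, mul_neg]
    one_lt := by
      have h1 := (hflux' (hsub hcm) (hsub hbm) hcb).trans_eq hcrit
      rw [deriv_flux hv' (hsub' hbm)] at h1
      rw [one_lt_div (pow_pos hvb 2), hqb]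
      nlinarith }

lemma isMonotoneProfile_iff {h M q a b : ℝ} {w W : ℝ → ℝ} (hk : IsAveragingKernel h M w)
    (hpos : ∀ x ∈ Icc a b, 0 < v x) :
    IsMonotoneProfile h w v q a b W ↔ IsProfile h a b w (fun x => q / v x) W := by
  constructor
  · rintro ⟨hc, hm, hI, he, hl, hr⟩
    exact ⟨hc, hm, hI, fun x =>
      (eq_div_iff (hpos _ (hk.avg_mem_Icc hm hI x)).ne').2 (he x), hl, hr⟩
  · intro hW
    exact ⟨hW.continuous, hW.monotone, hW.mem_Icc, fun x =>
      (eq_div_iff (hpos _ (hk.avg_mem_Icc hW.monotone hW.mem_Icc x)).ne').1 (hW.eq_avg x),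
      hW.tendsto_atBot, hW.tendsto_atTop⟩

end Velocity

/-- **Theorem 2.2.** For `ρ⁻ < ρ̂ < ρ⁺` in `(0,1)` with
`ρ⁻·v(ρ⁻) = ρ⁺·v(ρ⁺) = f̄`, a continuous monotone profile exists, and it is unique
up to horizontal shifts. -/
theorem stmt_4 (h : ℝ) (hh : 0 < h) (w : ℝ → ℝ)
    (hw_supp : ∀ x, x ∉ Ioo 0 h → w x = 0)
    (hw_cont : ContinuousOn w (Ioo 0 h))
    (hw_bdd : ∃ Mw, ∀ x, w x ≤ Mw)
    (hw_pos : ∀ x ∈ Ioo 0 h, 0 < w x)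
    (hw_anti : StrictAntiOn w (Ioo 0 h))
    (hw_int1 : (∫ s in (0:ℝ)..h, w s) = 1)
    (v : ℝ → ℝ) (hv : ContDiffOn ℝ 2 v (Icc 0 1))
    (hv0 : v 0 = 1) (hv1 : v 1 = 0)
    (hv'neg : ∀ ρ ∈ Icc (0:ℝ) 1, deriv v ρ < 0)
    (hv''np : ∀ ρ ∈ Icc (0:ℝ) 1, deriv (deriv v) ρ ≤ 0)
    (rhohat : ℝ) (hrhohat_mem : rhohat ∈ Ioo (0:ℝ) 1)
    (hrhohat_crit : deriv (fun ρ => ρ * v ρ) rhohat = 0)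
    (hrhohat_uniq : ∀ ρ ∈ Ioo (0:ℝ) 1, deriv (fun ρ => ρ * v ρ) ρ = 0 → ρ = rhohat)
    (rhom rhop fbar : ℝ)
    (hrhom : rhom ∈ Ioo (0:ℝ) 1) (hrhop : rhop ∈ Ioo (0:ℝ) 1)
    (hord : rhom < rhohat ∧ rhohat < rhop)
    (hfm : fbar = rhom * v rhom) (hfp : fbar = rhop * v rhop) :
    (∃ W : ℝ → ℝ, IsMonotoneProfile h w v fbar rhom rhop W) ∧
    (∀ W₁ W₂ : ℝ → ℝ, IsMonotoneProfile h w v fbar rhom rhop W₁ →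
      IsMonotoneProfile h w v fbar rhom rhop W₂ →
      ∃ c : ℝ, ∀ x, W₂ x = W₁ (x + c)) := by
  obtain ⟨M, hM⟩ := hw_bdd
  have hk : IsAveragingKernel h M w :=
    { pos_h := hh
      nonneg := fun s => by
        by_cases hs : s ∈ Ioo 0 h
        · exact (hw_pos s hs).le
        · exact (hw_supp s hs).ge
      le_bound := hM
      pos := hw_pos
      integral_eq_one := hw_int1 }
  obtain ⟨K, κ, hF⟩ := exists_isResponse hv hv1 hv'neg hv''np hrhohat_crit hrhom.1 hrhop.2
    hord.1 hord.2 hfm hfp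
  have hpos : ∀ x ∈ Icc rhom rhop, 0 < v x := fun x hx =>
    hv1.symm.trans_lt (strictAntiOn_of_deriv_neg_Icc hv'neg
      ⟨hrhom.1.le.trans hx.1, hx.2.trans hrhop.2.le⟩ (right_mem_Icc.2 zero_le_one)
      (hx.2.trans_lt hrhop.2))
  have hiff : ∀ {W}, IsMonotoneProfile h w v fbar rhom rhop W ↔
      IsProfile h rhom rhop w (fun x => fbar / v x) W := isMonotoneProfile_iff hk hpos
  obtain ⟨W, hW⟩ := exists_profile hk hF
  exact ⟨⟨W, hiff.2 hW⟩, fun W₁ W₂ h₁ h₂ =>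
    IsProfile.exists_eq_shift hk hF (hiff.1 h₁) (hiff.1 h₂)⟩
end

section
/- (Ordering of the profiles, Corollary 2.4.) Assume κ⁻ > κ⁺ > 0 and let ρ⁻, ρ⁺ ∈ (0,1) satisfy ρ⁻ < ρ̂ < ρ⁺ and f̄ := κ⁻ρ⁻v(ρ⁻) = κ⁺ρ⁺v(ρ⁺) > 0. Let Q₁ and Q₂ both be stationary profiles, i.e. monotone nondecreasing functions ℝ → [0,1], continuous on (−∞,0) and (0,∞), satisfying κ(x)·Q(x)·v(A(Q;x)) = f̄ for all x ≠ 0, the connecting condition κ⁻Q(0−) = κ⁺Q(0+), and lim_{x→−∞} Q(x) = ρ⁻, lim_{x→+∞} Q(x) = ρ⁺. If Q₁(x) > Q₂(x) for all x > 0, then also Q₁(x) > Q₂(x) for all x < 0; that is, the graphs of two profiles which are strictly ordered on (0,∞) never cross on (−∞,0). -/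
open Set Filter Topology MeasureTheory

/-- The rough road coefficient `κ(x) = κ⁻` for `x < 0`, `κ(x) = κ⁺` for `x > 0`. -/
noncomputable def kappa (km kp : ℝ) (x : ℝ) : ℝ := if x < 0 then km else kp

/-- A stationary profile for model (M1): `Q : ℝ → [0,1]` monotone nondecreasing,
continuous on `(−∞,0)` and `(0,∞)`, satisfying `κ(x)·Q(x)·v(A(Q;x)) = f̄` for `x ≠ 0`,
the connecting condition `κ⁻·Q(0−) = κ⁺·Q(0+)`, and with limits `ρ⁻` at `−∞`,
`ρ⁺` at `+∞`. -/
def IsProfileM1 (h : ℝ) (w v : ℝ → ℝ) (km kp fbar rhom rhop : ℝ) (Q : ℝ → ℝ) : Prop :=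
  (∀ x, Q x ∈ Set.Icc (0:ℝ) 1) ∧ Monotone Q ∧
  ContinuousOn Q (Set.Iio 0) ∧ ContinuousOn Q (Set.Ioi 0) ∧
  (∀ x ≠ (0:ℝ), kappa km kp x * Q x * v (avg h w Q x) = fbar) ∧
  (∃ qm qp : ℝ, Filter.Tendsto Q (nhdsWithin 0 (Set.Iio 0)) (nhds qm) ∧
    Filter.Tendsto Q (nhdsWithin 0 (Set.Ioi 0)) (nhds qp) ∧ km * qm = kp * qp) ∧
  Filter.Tendsto Q Filter.atBot (nhds rhom) ∧ Filter.Tendsto Q Filter.atTop (nhds rhop)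

section Average

variable {h : ℝ} {w P Q : ℝ → ℝ}

theorem intervalIntegrable_weight (hh : 0 < h) (hQm : Measurable Q)
    (hQ : ∀ x, Q x ∈ Icc (0 : ℝ) 1) (hw : IntervalIntegrable w volume 0 h) (x : ℝ) :
    IntervalIntegrable (fun s => Q (x + s) * w s) volume 0 h := by
  rw [intervalIntegrable_iff_integrableOn_Ioc_of_le hh.le] at hw ⊢
  refine Integrable.bdd_mul (c := 1) hw
    (hQm.comp (measurable_const_add x)).aestronglyMeasurable (ae_of_all _ fun s => ?_)
  rw [Real.norm_eq_abs, abs_of_nonneg (hQ _).1]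
  exact (hQ _).2

theorem avg_mem_Icc (hh : 0 < h) (hQm : Measurable Q) (hQ : ∀ x, Q x ∈ Icc (0 : ℝ) 1)
    (hw : IntervalIntegrable w volume 0 h) (hw0 : ∀ s, 0 ≤ w s)
    (hw1 : ∫ s in (0 : ℝ)..h, w s = 1) (x : ℝ) : avg h w Q x ∈ Icc (0 : ℝ) 1 := by
  constructor
  · exact intervalIntegral.integral_nonneg hh.le fun s _ => mul_nonneg (hQ _).1 (hw0 s)
  · rw [← hw1]
    exact intervalIntegral.integral_mono hh.le (intervalIntegrable_weight hh hQm hQ hw x) hw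
      fun s => mul_le_of_le_one_left (hw0 s) (hQ _).2

theorem continuous_avg (hh : 0 < h) (hQm : Measurable Q) (hQ : ∀ x, Q x ∈ Icc (0 : ℝ) 1)
    (hQc : ∀ x ≠ 0, ContinuousAt Q x) (hw : IntervalIntegrable w volume 0 h) :
    Continuous (avg h w Q) := by
  rw [continuous_iff_continuousAt]
  intro x
  refine intervalIntegral.continuousAt_of_dominated_interval (bound := fun s => ‖w s‖)
    (Eventually.of_forall fun y => ?_) (Eventually.of_forall fun y => ae_of_all _ fun s _ => ?_)
    hw.norm ?_
  · exact (intervalIntegrable_weight hh hQm hQ hw y).def'.aestronglyMeasurable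
  · rw [norm_mul, Real.norm_eq_abs, abs_of_nonneg (hQ _).1]
    exact mul_le_of_le_one_left (norm_nonneg _) (hQ _).2
  · filter_upwards [compl_mem_ae_iff.2 (measure_singleton (μ := volume) (-x))] with s hs _
    have hne : x + s ≠ 0 := fun h0 => hs (by rw [mem_singleton_iff]; linarith)
    have hadd : ContinuousAt (fun y => y + s) x := by fun_prop
    exact (ContinuousAt.comp' (g := Q) (f := fun y => y + s) (hQc _ hne) hadd).mul continuousAt_const

theorem avg_lt_avg (hh : 0 < h) (hPm : Measurable P) (hP : ∀ x, P x ∈ Icc (0 : ℝ) 1)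
    (hQm : Measurable Q) (hQ : ∀ x, Q x ∈ Icc (0 : ℝ) 1)
    (hw : IntervalIntegrable w volume 0 h) (hw0 : ∀ s ∈ Ioo 0 h, 0 < w s)
    {x : ℝ} (hPQ : ∀ y > x, y ≠ 0 → P y < Q y) : avg h w P x < avg h w Q x := by
  have hlt : ∀ᵐ s ∂volume.restrict (Ioc 0 h), P (x + s) * w s < Q (x + s) * w s := by
    rw [← restrict_Ioo_eq_restrict_Ioc, ae_restrict_iff' measurableSet_Ioo]
    filter_upwards [compl_mem_ae_iff.2 (measure_singleton (μ := volume) (-x))] with s hs hsI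
    have hne : x + s ≠ 0 := fun h0 => hs (by rw [mem_singleton_iff]; linarith)
    exact mul_lt_mul_of_pos_right (hPQ _ (by linarith [hsI.1]) hne) (hw0 s hsI)
  refine intervalIntegral.integral_lt_integral_of_ae_le_of_measure_setOfPred_lt_ne_zero hh.le
    (intervalIntegrable_weight hh hPm hP hw x) (intervalIntegrable_weight hh hQm hQ hw x)
    (hlt.mono fun _ => le_of_lt) ?_
  rw [measure_eq_measure_of_null_sdiff (subset_univ _) (by
    rw [← compl_eq_univ_sdiff]; exact hlt)]
  simp [hh]

end Average

theorem IsProfileM1.continuousAt {h : ℝ} {w v Q : ℝ → ℝ} {km kp fbar rhom rhop : ℝ}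
    (hQ : IsProfileM1 h w v km kp fbar rhom rhop Q) {x : ℝ} (hx : x ≠ 0) :
    ContinuousAt Q x := by
  obtain ⟨-, -, hneg, hpos, -⟩ := hQ
  rcases lt_or_gt_of_ne hx with hx | hx
  · exact hneg.continuousAt (Iio_mem_nhds hx)
  · exact hpos.continuousAt (Ioi_mem_nhds hx)

theorem IsProfileM1.lt_of_avg_lt {h : ℝ} {w v Q₁ Q₂ : ℝ → ℝ} {km kp fbar rhom rhop : ℝ}
    (hQ₁ : IsProfileM1 h w v km kp fbar rhom rhop Q₁)
    (hQ₂ : IsProfileM1 h w v km kp fbar rhom rhop Q₂)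
    (hkm : 0 < km) (hfbar : 0 < fbar) (hv : StrictAntiOn v (Icc 0 1)) {x : ℝ} (hx : x < 0)
    (h₁ : avg h w Q₁ x ∈ Icc (0 : ℝ) 1) (h₂ : avg h w Q₂ x ∈ Icc (0 : ℝ) 1)
    (hlt : avg h w Q₂ x < avg h w Q₁ x) : Q₂ x < Q₁ x := by
  obtain ⟨hr₁, -, -, -, he₁, -⟩ := hQ₁
  obtain ⟨hr₂, -, -, -, he₂, -⟩ := hQ₂
  have e₁ := he₁ x hx.ne
  have e₂ := he₂ x hx.ne
  simp only [kappa, if_pos hx] at e₁ e₂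
  have hvlt := hv h₂ h₁ hlt
  have hv₁ : 0 < v (avg h w Q₁ x) :=
    pos_of_mul_pos_right (e₁ ▸ hfbar) (mul_nonneg hkm.le (hr₁ x).1)
  have hQpos : 0 < km * Q₂ x :=
    pos_of_mul_pos_left (e₂ ▸ hfbar) (hv₁.trans hvlt).le
  by_contra! hle
  have hstep : km * Q₁ x * v (avg h w Q₁ x) ≤ km * Q₂ x * v (avg h w Q₁ x) := by gcongr
  linarith [mul_lt_mul_of_pos_left hvlt hQpos]

/-- **Corollary 2.4, ordering of the profiles.** In Case A1, two stationary
profiles that are strictly ordered on `(0,∞)` are also strictly ordered on `(−∞,0)`: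
their graphs never cross. -/
theorem stmt_7 (h : ℝ) (hh : 0 < h) (w : ℝ → ℝ)
    (hw_supp : ∀ x, x ∉ Ioo 0 h → w x = 0)
    (hw_cont : ContinuousOn w (Ioo 0 h))
    (hw_bdd : ∃ Mw, ∀ x, w x ≤ Mw)
    (hw_pos : ∀ x ∈ Ioo 0 h, 0 < w x)
    (hw_anti : StrictAntiOn w (Ioo 0 h))
    (hw_int1 : (∫ s in (0:ℝ)..h, w s) = 1)
    (v : ℝ → ℝ) (hv : ContDiffOn ℝ 2 v (Icc 0 1))
    (hv0 : v 0 = 1) (hv1 : v 1 = 0)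
    (hv'neg : ∀ ρ ∈ Icc (0:ℝ) 1, deriv v ρ < 0)
    (hv''np : ∀ ρ ∈ Icc (0:ℝ) 1, deriv (deriv v) ρ ≤ 0)
    (rhohat : ℝ) (hrhohat_mem : rhohat ∈ Ioo (0:ℝ) 1)
    (hrhohat_crit : deriv (fun ρ => ρ * v ρ) rhohat = 0)
    (hrhohat_uniq : ∀ ρ ∈ Ioo (0:ℝ) 1, deriv (fun ρ => ρ * v ρ) ρ = 0 → ρ = rhohat)
    (km kp : ℝ) (hk : 0 < kp ∧ kp < km)
    (rhom rhop fbar : ℝ)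
    (hrhom : rhom ∈ Ioo (0:ℝ) 1) (hrhop : rhop ∈ Ioo (0:ℝ) 1)
    (hord : rhom < rhohat ∧ rhohat < rhop)
    (hfm : fbar = km * (rhom * v rhom)) (hfp : fbar = kp * (rhop * v rhop))
    (hfpos : 0 < fbar)
    (Q₁ Q₂ : ℝ → ℝ)
    (hQ₁ : IsProfileM1 h w v km kp fbar rhom rhop Q₁)
    (hQ₂ : IsProfileM1 h w v km kp fbar rhom rhop Q₂)
    (hgt : ∀ x > (0:ℝ), Q₂ x < Q₁ x) :
    ∀ x < (0:ℝ), Q₂ x < Q₁ x := by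
  obtain ⟨hkp, hkpm⟩ := hk
  have hkm : 0 < km := hkp.trans hkpm
  have hvanti : StrictAntiOn v (Icc 0 1) :=
    strictAntiOn_of_deriv_neg (convex_Icc 0 1) hv.continuousOn
      fun x hx => hv'neg x (interior_subset hx)
  have hw : IntervalIntegrable w volume 0 h :=
    intervalIntegral.intervalIntegrable_of_integral_ne_zero (by rw [hw_int1]; exact one_ne_zero)
  have hw0 : ∀ s, 0 ≤ w s := fun s => by
    by_cases hs : s ∈ Ioo 0 h
    · exact (hw_pos s hs).le
    · exact (hw_supp s hs).ge
  have hm₁ : Measurable Q₁ := hQ₁.2.1.measurable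
  have hm₂ : Measurable Q₂ := hQ₂.2.1.measurable
  have hc₁ := continuous_avg hh hm₁ hQ₁.1 (fun _ => hQ₁.continuousAt) hw
  have hc₂ := continuous_avg hh hm₂ hQ₂.1 (fun _ => hQ₂.continuousAt) hw
  have key : ∀ x < 0, avg h w Q₂ x < avg h w Q₁ x → Q₂ x < Q₁ x := fun x hx =>
    hQ₁.lt_of_avg_lt hQ₂ hkm hfpos hvanti hx
      (avg_mem_Icc hh hm₁ hQ₁.1 hw hw0 hw_int1 x) (avg_mem_Icc hh hm₂ hQ₂.1 hw hw0 hw_int1 x)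
  intro x hx
  by_contra hcross
  set T : Set ℝ := {y | y ≤ 0 ∧ avg h w Q₁ y ≤ avg h w Q₂ y} with hT
  have hTclosed : IsClosed T := isClosed_Iic.inter (isClosed_le hc₁ hc₂)
  have hTbdd : BddAbove T := ⟨0, fun y hy => hy.1⟩
  have hxT : x ∈ T := ⟨hx.le, not_lt.1 fun hlt => hcross (key x hx hlt)⟩
  have hsup : sSup T ∈ T := hTclosed.csSup_mem ⟨x, hxT⟩ hTbdd
  refine (avg_lt_avg hh hm₂ hQ₂.1 hm₁ hQ₁.1 hw hw_pos fun y hy hy0 => ?_).not_ge hsup.2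
  rcases lt_or_gt_of_ne hy0 with hneg | hpos
  · refine key y hneg (not_le.1 fun hle => ?_)
    exact (le_csSup hTbdd ⟨hneg.le, hle⟩).not_gt hy
  · exact hgt y hpos
end

section
/- (Derivative comparison at a touching point.) Let v be C² on [0,1] with v' < 0 and v'' ≤ 0, and let w be C¹ on [0,h] with w ≥ 0, w(h) = 0, w'(s) < 0 for s ∈ (0,h), and w = 0 outside (0,h). Let y ∈ ℝ and let Q, R : ℝ → [0,1] be continuous functions, both differentiable at y, such that: Q is monotone nondecreasing, Q(y) = R(y) > 0, Q'(y) = R'(y), and Q(x) > R(x) for all x > y. Then the derivative of x ↦ Q(x)·v(A(Q;x)) at x = y is strictly smaller than the derivative of x ↦ R(x)·v(A(R;x)) at x = y. (Consequently, if Q satisfies the stationary equation Q(x)·v(A(Q;x)) ≡ const near y, then the PDE flux derivative of R at y is strictly positive, so ρ_t < 0 at a touching maximum.) -/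
open Set Filter Topology MeasureTheory

/-- A function that is `C¹` on `[a, b]` has an interval integrable derivative. -/
theorem ContDiffOn.intervalIntegrable_deriv {a b : ℝ} {f : ℝ → ℝ} (hab : a < b)
    (hf : ContDiffOn ℝ 1 f (Icc a b)) : IntervalIntegrable (deriv f) volume a b := by
  have hcont : ContinuousOn (derivWithin f (Icc a b)) (Icc a b) :=
    hf.continuousOn_derivWithin (uniqueDiffOn_Icc hab) le_rfl
  refine (hcont.intervalIntegrable_of_Icc hab.le).congr_uIoo fun x hx => ?_
  rw [uIoo_of_le hab.le] at hx
  exact derivWithin_of_mem_nhds (Icc_mem_nhds hx.1 hx.2)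

/-- The derivative of a nonlocal average of a bounded continuous function, for a `C¹` weight
vanishing at the right end point. -/
theorem hasDerivAt_avg {h C : ℝ} {w Q : ℝ → ℝ} (hh : 0 < h) (hw : ContDiffOn ℝ 1 w (Icc 0 h))
    (hwh : w h = 0) (hQc : Continuous Q) (hQb : ∀ x, ‖Q x‖ ≤ C) (y : ℝ) :
    HasDerivAt (avg h w Q) (∫ s in (0:ℝ)..h, (Q (y + s) - Q y) * -deriv w s) y := by
  have hwi : IntervalIntegrable (deriv w) volume 0 h := hw.intervalIntegrable_deriv hh
  have hwd : ∀ s ∈ Ioo 0 h, HasDerivAt w (deriv w s) s := fun s hs =>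
    ((hw.differentiableOn one_ne_zero).differentiableAt (Icc_mem_nhds hs.1 hs.2)).hasDerivAt
  set P : ℝ → ℝ := fun x => ∫ t in (0:ℝ)..x, Q t
  have hPd : ∀ x, HasDerivAt P (Q x) x := fun x => hQc.integral_hasStrictDerivAt 0 x |>.hasDerivAt
  have hPc : Continuous P := continuous_iff_continuousAt.2 fun x => (hPd x).continuousAt
  have hparts : avg h w Q = fun x => -(P x * w 0) - ∫ s in (0:ℝ)..h, P (x + s) * deriv w s := by
    funext x
    have := intervalIntegral.integral_mul_deriv_eq_deriv_mul_of_hasDerivAt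
      (u := fun s => P (x + s)) (u' := fun s => Q (x + s)) (v := w) (v' := deriv w)
      (a := 0) (b := h)
      (by fun_prop) (by rw [uIcc_of_le hh.le]; exact hw.continuousOn)
      (fun s _ => (hPd (x + s)).comp_const_add x s)
      (fun s hs => hwd s (by rwa [min_eq_left hh.le, max_eq_right hh.le] at hs))
      (Continuous.intervalIntegrable (by fun_prop) _ _) hwi
    simp only [hwh, mul_zero, add_zero, zero_sub] at this
    rw [avg, this]
    ring
  have hint := intervalIntegral.hasDerivAt_integral_of_dominated_loc_of_deriv_le
    (F := fun x s => P (x + s) * deriv w s) (F' := fun x s => Q (x + s) * deriv w s)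
    (bound := fun s => C * ‖deriv w s‖) (μ := volume) (a := 0) (b := h) (x₀ := y) (s := univ)
    univ_mem
    (Eventually.of_forall fun x =>
      (hwi.continuousOn_mul (g := fun s => P (x + s)) (by fun_prop)).aestronglyMeasurable_restrict_uIoc)
    (hwi.continuousOn_mul (by fun_prop))
    (hwi.continuousOn_mul (g := fun s => Q (y + s)) (by fun_prop)).aestronglyMeasurable_restrict_uIoc
    (Eventually.of_forall fun s _ x _ => by
      rw [norm_mul]
      exact mul_le_mul_of_nonneg_right (hQb _) (norm_nonneg _))
    (hwi.norm.const_mul C)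
    (Eventually.of_forall fun s _ x _ => ((hPd (x + s)).comp_add_const x s).mul_const _)
  have hw0 : ∫ s in (0:ℝ)..h, deriv w s = w h - w 0 :=
    intervalIntegral.integral_eq_sub_of_hasDerivAt_of_le hh.le hw.continuousOn hwd hwi
  rw [hparts]
  refine (((hPd y).mul_const (w 0)).neg.sub hint.2).congr_deriv (Eq.symm ?_)
  calc ∫ s in (0:ℝ)..h, (Q (y + s) - Q y) * -deriv w s
      = ∫ s in (0:ℝ)..h, (Q y * deriv w s - Q (y + s) * deriv w s) := by
        congr 1 with s
        ring
    _ = -(Q y * w 0) - ∫ s in (0:ℝ)..h, Q (y + s) * deriv w s := by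
        rw [intervalIntegral.integral_sub (hwi.const_mul _) hint.1,
          intervalIntegral.integral_const_mul, hw0, hwh]
        ring

/-- A nonlocal average with a nonnegative weight of total mass one preserves `[0, 1]`. -/
theorem avg_mem_Icc_s8 {h : ℝ} {w Q : ℝ → ℝ} (hh : 0 ≤ h) (hw : ContinuousOn w (Icc 0 h))
    (hw_nonneg : ∀ x, 0 ≤ w x) (hw_int1 : (∫ s in (0:ℝ)..h, w s) = 1)
    (hQc : Continuous Q) (hQr : ∀ x, Q x ∈ Icc (0:ℝ) 1) (x : ℝ) :
    avg h w Q x ∈ Icc (0:ℝ) 1 := by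
  have hwi : IntervalIntegrable w volume 0 h := hw.intervalIntegrable_of_Icc hh
  refine ⟨intervalIntegral.integral_nonneg hh fun s _ => mul_nonneg (hQr _).1 (hw_nonneg s), ?_⟩
  rw [← hw_int1]
  exact intervalIntegral.integral_mono_on hh (hwi.continuousOn_mul (by fun_prop)) hwi
    fun s _ => mul_le_of_le_one_left (hw_nonneg s) (hQr _).2

/-- If `Q > R` to the right of `y`, then `Q` has the larger integral against a weight that is
positive on `(0, h)`, even after subtracting the common value at `y`. -/
theorem integral_sub_mul_lt {h y c : ℝ} {g Q R : ℝ → ℝ} (hh : 0 < h)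
    (hg : IntervalIntegrable g volume 0 h) (hg_pos : ∀ s ∈ Ioo 0 h, 0 < g s)
    (hQc : Continuous Q) (hRc : Continuous R) (hgt : ∀ x, y < x → R x < Q x) :
    (∫ s in (0:ℝ)..h, (R (y + s) - c) * g s) < ∫ s in (0:ℝ)..h, (Q (y + s) - c) * g s := by
  have hQi : IntervalIntegrable (fun s => (Q (y + s) - c) * g s) volume 0 h :=
    hg.continuousOn_mul (by fun_prop)
  have hRi : IntervalIntegrable (fun s => (R (y + s) - c) * g s) volume 0 h :=
    hg.continuousOn_mul (by fun_prop)
  rw [← sub_pos, ← intervalIntegral.integral_sub hQi hRi]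
  refine intervalIntegral.intervalIntegral_pos_of_pos_on (hQi.sub hRi) (fun s hs => ?_) hh
  have := mul_pos (sub_pos.2 (hgt (y + s) (by linarith [hs.1]))) (hg_pos s hs)
  linarith

/-- **derivative comparison at a touching point.** Let `Q, R : ℝ → [0,1]` be
continuous, differentiable at `y`, with `Q` monotone nondecreasing, `Q(y) = R(y) > 0`,
`Q'(y) = R'(y)`, and `Q > R` on `(y,∞)`.  Then the derivative of `x ↦ Q(x)·v(A(Q;x))` at
`y` is strictly smaller than that of `x ↦ R(x)·v(A(R;x))` at `y`. -/
theorem stmt_8 (h : ℝ) (hh : 0 < h) (v w : ℝ → ℝ)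
    (hv : ContDiffOn ℝ 2 v (Icc 0 1))
    (hv'neg : ∀ ρ ∈ Icc (0:ℝ) 1, deriv v ρ < 0)
    (hv''np : ∀ ρ ∈ Icc (0:ℝ) 1, deriv (deriv v) ρ ≤ 0)
    (hw : ContDiffOn ℝ 1 w (Icc 0 h))
    (hw_nonneg : ∀ x, 0 ≤ w x) (hwh : w h = 0)
    (hw'neg : ∀ s ∈ Ioo 0 h, deriv w s < 0)
    (hw_supp_neg : ∀ x, x < 0 → w x = 0)
    (hw_supp_ge : ∀ x, h ≤ x → w x = 0)
    (hw_int1 : (∫ s in (0:ℝ)..h, w s) = 1)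
    (y : ℝ) (Q R : ℝ → ℝ)
    (hQc : Continuous Q) (hRc : Continuous R)
    (hQr : ∀ x, Q x ∈ Icc (0:ℝ) 1) (hRr : ∀ x, R x ∈ Icc (0:ℝ) 1)
    (hQd : DifferentiableAt ℝ Q y) (hRd : DifferentiableAt ℝ R y)
    (hQmono : Monotone Q)
    (htouch : Q y = R y) (hpos : 0 < Q y)
    (hder : deriv Q y = deriv R y)
    (hgt : ∀ x, y < x → R x < Q x) :
    deriv (fun x => Q x * v (avg h w Q x)) y
      < deriv (fun x => R x * v (avg h w R x)) y := by
  have hvd : ∀ ρ ∈ Icc (0:ℝ) 1, DifferentiableAt ℝ v ρ := fun ρ hρ =>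
    differentiableAt_of_deriv_ne_zero (hv'neg ρ hρ).ne
  have hv_anti : StrictAntiOn v (Icc 0 1) :=
    strictAntiOn_of_deriv_neg (convex_Icc 0 1) hv.continuousOn fun ρ hρ =>
      hv'neg ρ (interior_subset hρ)
  have hv'_anti : AntitoneOn (deriv v) (Icc 0 1) := by
    refine antitoneOn_of_deriv_nonpos (convex_Icc 0 1) ?_ ?_ fun ρ hρ =>
      hv''np ρ (interior_subset hρ)
    · refine (hv.continuousOn_derivWithin (uniqueDiffOn_Icc one_pos) one_le_two).congr
        fun ρ hρ => ?_
      exact ((hvd ρ hρ).derivWithin (uniqueDiffOn_Icc one_pos ρ hρ)).symm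
    · have hv₂ : ContDiffOn ℝ (1 + 1) v (interior (Icc 0 1)) := by
        rw [one_add_one_eq_two]
        exact hv.mono interior_subset
      exact ((contDiffOn_succ_iff_deriv_of_isOpen isOpen_interior).1 hv₂).2.2.differentiableOn
        one_ne_zero
  have hw_anti : StrictAntiOn w (Icc 0 h) :=
    strictAntiOn_of_deriv_neg (convex_Icc 0 h) hw.continuousOn fun s hs =>
      hw'neg s (by rwa [interior_Icc] at hs)
  have hw_pos : ∀ s ∈ Ioo 0 h, 0 < w s := fun s hs =>
    hwh ▸ hw_anti (Ioo_subset_Icc_self hs) (right_mem_Icc.2 hh.le) hs.2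
  have hnorm : ∀ S : ℝ → ℝ, (∀ x, S x ∈ Icc (0:ℝ) 1) → ∀ x, ‖S x‖ ≤ 1 := fun S hS x => by
    rw [Real.norm_of_nonneg (hS x).1]
    exact (hS x).2
  have hAQ := hasDerivAt_avg hh hw hwh hQc (hnorm Q hQr) y
  have hAR := hasDerivAt_avg hh hw hwh hRc (hnorm R hRr) y
  have hAQmem := avg_mem_Icc_s8 hh.le hw.continuousOn hw_nonneg hw_int1 hQc hQr y
  have hARmem := avg_mem_Icc_s8 hh.le hw.continuousOn hw_nonneg hw_int1 hRc hRr y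
  have hA_lt : avg h w R y < avg h w Q y := by
    simpa [avg] using integral_sub_mul_lt (c := 0) hh
      (hw.continuousOn.intervalIntegrable_of_Icc hh.le) hw_pos hQc hRc hgt
  have hA'_lt := integral_sub_mul_lt (c := Q y) hh (hw.intervalIntegrable_deriv hh).neg
    (fun s hs => neg_pos.2 (hw'neg s hs)) hQc hRc hgt
  have hA'_nonneg : 0 ≤ ∫ s in (0:ℝ)..h, (Q (y + s) - Q y) * -deriv w s := by
    rw [intervalIntegral.integral_of_le hh.le, integral_Ioc_eq_integral_Ioo]
    exact setIntegral_nonneg measurableSet_Ioo fun s hs =>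
      mul_nonneg (sub_nonneg.2 (hQmono (by linarith [hs.1]))) (neg_nonneg.2 (hw'neg s hs).le)
  rw [← htouch] at hAR
  have hdQ := hQd.hasDerivAt.fun_mul ((hvd _ hAQmem).hasDerivAt.comp y hAQ)
  have hdR := hRd.hasDerivAt.fun_mul ((hvd _ hARmem).hasDerivAt.comp y hAR)
  simp only [Function.comp_apply] at hdQ hdR
  rw [hdQ.deriv, hdR.deriv, ← hder, ← htouch]
  refine add_lt_add_of_le_of_lt
    (mul_le_mul_of_nonneg_left (hv_anti hARmem hAQmem hA_lt).le hQmono.deriv_nonneg)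
    (mul_lt_mul_of_pos_left ?_ hpos)
  exact (mul_le_mul_of_nonneg_right (hv'_anti hARmem hAQmem hA_lt.le) hA'_nonneg).trans_lt
    (mul_lt_mul_of_neg_left hA'_lt (hv'neg _ hARmem))
end
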